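/- arXiv:2504.01630 — 8 statements merged into one kernel-verified Lean document; each statement's English description precedes it below -/
import Mathlib

section
/- Let d ∈ ℕ, let Θ ⊂ ℝ^d be a nonempty C^1-hypersurface of positive reach, and suppose that (a) there exists ε ∈ (0, reach(Θ)) such that μ : ℝ^d → ℝ^d and σ : ℝ^d → ℝ^{d×d} are bounded on Θ^ε, (b) μ is intrinsic Lipschitz continuous on ℝ^d \ Θ, and (c) σ is Lipschitz continuous on ℝ^d. Then there exists c ∈ (0,∞) such that for all x ∈ ℝ^d, ‖μ(x)‖ + ‖σ(x)‖ ≤ c(1 + ‖x‖). -/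
open Set Metric Filter MeasureTheory
open scoped ENNReal NNReal RealInnerProductSpace ContDiff

noncomputable section

/-- The hyperplane `ℝ^{d-1} × {0}` inside `ℝ^d` (equal to `{0}` when `d = 1`). -/
def hyperplane (d : ℕ) : Set (EuclideanSpace ℝ (Fin d)) :=
  {y | ∀ i : Fin d, (i : ℕ) = d - 1 → y i = 0}

/-- `M ⊆ ℝ^d` is a `C^k`-hypersurface: every point of `M` admits a `C^k`-chart
flattening `M` onto the hyperplane `ℝ^{d-1} × {0}`. -/
def IsCkHypersurface {d : ℕ} (k : ℕ∞) (M : Set (EuclideanSpace ℝ (Fin d))) : Prop :=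
  ∀ x ∈ M, ∃ U V : Set (EuclideanSpace ℝ (Fin d)),
    ∃ φ ψ : EuclideanSpace ℝ (Fin d) → EuclideanSpace ℝ (Fin d),
      IsOpen U ∧ IsOpen V ∧ x ∈ U ∧
      ContDiffOn ℝ k φ U ∧ ContDiffOn ℝ k ψ V ∧
      Set.MapsTo φ U V ∧ Set.MapsTo ψ V U ∧
      (∀ y ∈ U, ψ (φ y) = y) ∧ (∀ y ∈ V, φ (ψ y) = y) ∧
      φ '' (M ∩ U) = hyperplane d ∩ V

/-- `v` is a tangent vector to `M` at `x`: there is a `C^1`-curve in `M` through `x`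
with velocity `v`. -/
def IsTangentVector {d : ℕ} (M : Set (EuclideanSpace ℝ (Fin d)))
    (x v : EuclideanSpace ℝ (Fin d)) : Prop :=
  ∃ ε : ℝ, 0 < ε ∧ ∃ γ : ℝ → EuclideanSpace ℝ (Fin d),
    (∀ t ∈ Set.Ioo (-ε) ε, γ t ∈ M) ∧ ContDiffOn ℝ 1 γ (Set.Ioo (-ε) ε) ∧
    γ 0 = x ∧ HasDerivAt γ v 0

/-- `n` is a (unit) normal vector field along `M`. -/
def IsNormalVector {d : ℕ} (M : Set (EuclideanSpace ℝ (Fin d)))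
    (n : EuclideanSpace ℝ (Fin d) → EuclideanSpace ℝ (Fin d)) : Prop :=
  ContinuousOn n M ∧ (∀ x ∈ M, ‖n x‖ = 1) ∧
    ∀ x ∈ M, ∀ v, IsTangentVector M x v → ⟪n x, v⟫ = 0

/-- The set of points having a unique nearest point in `M`. -/
def unp {d : ℕ} (M : Set (EuclideanSpace ℝ (Fin d))) : Set (EuclideanSpace ℝ (Fin d)) :=
  {x | ∃! p, p ∈ M ∧ dist x p = Metric.infDist x M}

/-- `p` is a nearest point to `x` in `M`. -/
def IsNearestPt {d : ℕ} (M : Set (EuclideanSpace ℝ (Fin d)))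
    (x p : EuclideanSpace ℝ (Fin d)) : Prop :=
  p ∈ M ∧ dist x p = Metric.infDist x M

/-- The reach of `M`, as an extended nonnegative real:
`reach M = sup {ε ≥ 0 | M^ε ⊆ unp M}` where `M^ε` is the open `ε`-neighbourhood. -/
def reach {d : ℕ} (M : Set (EuclideanSpace ℝ (Fin d))) : ℝ≥0∞ :=
  sSup {r : ℝ≥0∞ | ∃ ε : ℝ, 0 ≤ ε ∧ r = ENNReal.ofReal ε ∧
    {x | Metric.infDist x M < ε} ⊆ unp M}

/-- The intrinsic (geodesic) metric of `A`: the infimum of lengths of continuous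
curves in `A` joining `x` to `y` (`∞` if there is none). -/
def intrinsicDist {d : ℕ} (A : Set (EuclideanSpace ℝ (Fin d)))
    (x y : EuclideanSpace ℝ (Fin d)) : ℝ≥0∞ :=
  ⨅ (γ : ℝ → EuclideanSpace ℝ (Fin d)) (_ : ContinuousOn γ (Set.Icc 0 1))
    (_ : Set.MapsTo γ (Set.Icc 0 1) A) (_ : γ 0 = x) (_ : γ 1 = y),
    eVariationOn γ (Set.Icc 0 1)

/-- `f` is intrinsic Lipschitz continuous on `A` with intrinsic Lipschitz constant `L`. -/
def IntrinsicLipschitzWith {d : ℕ} {F : Type*} [PseudoEMetricSpace F] (L : ℝ≥0)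
    (A : Set (EuclideanSpace ℝ (Fin d))) (f : EuclideanSpace ℝ (Fin d) → F) : Prop :=
  ∀ x ∈ A, ∀ y ∈ A, edist (f x) (f y) ≤ (L : ℝ≥0∞) * intrinsicDist A x y

end
/-- The intrinsic distance is bounded by the Euclidean one when the segment lies in the set. -/
lemma intrinsicDist_le_edist_of_segment_subset {d : ℕ} {A : Set (EuclideanSpace ℝ (Fin d))}
    {x y : EuclideanSpace ℝ (Fin d)} (h : segment ℝ x y ⊆ A) :
    intrinsicDist A x y ≤ edist x y := by
  have hlip : LipschitzWith (nndist x y) (AffineMap.lineMap x y : ℝ → _) :=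
    lipschitzWith_lineMap x y
  refine iInf_le_of_le (AffineMap.lineMap x y : ℝ → _) <|
    iInf_le_of_le hlip.continuous.continuousOn <| iInf_le_of_le ?_ <|
    iInf_le_of_le (by simp) <| iInf_le_of_le (by simp) ?_
  · intro t ht
    apply h
    rw [segment_eq_image_lineMap]
    exact mem_image_of_mem _ ht
  · calc eVariationOn (AffineMap.lineMap x y : ℝ → _) (Icc 0 1)
        ≤ nndist x y * eVariationOn (id : ℝ → ℝ) (Icc 0 1) :=
          (hlip.lipschitzOnWith (s := univ)).comp_eVariationOn_le (mapsTo_univ _ _)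
      _ ≤ nndist x y * ENNReal.ofReal (1 - 0) := by
          gcongr
          simp
      _ = edist x y := by rw [sub_zero, ENNReal.ofReal_one, mul_one, edist_nndist]

/-- From a point at distance at least `ε` from `s` one can move straight into the
`ε`-neighbourhood of `s` without meeting `s`, along a segment no longer than the distance
to `s`. -/
lemma exists_infDist_lt_segment_subset_compl {E : Type*} [NormedAddCommGroup E]
    [NormedSpace ℝ E] {s : Set E} (hs : s.Nonempty) {ε : ℝ} (hε : 0 < ε) {x : E}
    (hx : ε ≤ infDist x s) :
    ∃ y, infDist y s < ε ∧ segment ℝ x y ⊆ sᶜ ∧ dist x y ≤ infDist x s := by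
  obtain ⟨q, hq, hxq⟩ := (infDist_lt_iff hs).1 (lt_add_of_pos_right (infDist x s) (half_pos hε))
  have hle : infDist x s ≤ dist x q := infDist_le_dist_of_mem hq
  have hpos : 0 < dist x q := by linarith
  set t := (infDist x s - ε / 2) / dist x q with ht
  have htm : t * dist x q = infDist x s - ε / 2 := by rw [ht]; field_simp
  have ht0 : 0 ≤ t := div_nonneg (by linarith) hpos.le
  have ht1 : t ≤ 1 := (div_le_one hpos).2 (by linarith)
  have hxy : dist x (AffineMap.lineMap x q t) = infDist x s - ε / 2 := by
    rw [dist_left_lineMap, Real.norm_of_nonneg ht0, htm]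
  refine ⟨AffineMap.lineMap x q t, ?_, ?_, by linarith⟩
  · calc infDist (AffineMap.lineMap x q t) s ≤ dist (AffineMap.lineMap x q t) q :=
          infDist_le_dist_of_mem hq
      _ = dist x q - t * dist x q := by
          rw [dist_lineMap_right, Real.norm_of_nonneg (sub_nonneg.2 ht1)]; ring
      _ < ε := by linarith
  · intro z hz hzs
    have hxz : dist x z ≤ dist x (AffineMap.lineMap x q t) := by
      linarith [dist_add_dist_of_mem_segment hz,
        dist_nonneg (x := z) (y := AffineMap.lineMap x q t)]
    linarith [infDist_le_dist_of_mem (x := x) hzs]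

/-- linear growth of the coefficients. Let `Θ ⊆ ℝ^d` be a nonempty
`C^1`-hypersurface of positive reach. Assume that for some `ε ∈ (0, reach Θ)` the maps
`μ : ℝ^d → ℝ^d` and `σ : ℝ^d → ℝ^{d×d}` are bounded on the `ε`-neighbourhood `Θ^ε`,
that `μ` is intrinsic Lipschitz continuous on `ℝ^d \ Θ` and that `σ` is Lipschitz
continuous on `ℝ^d`. Then there is `c ∈ (0,∞)` with
`‖μ x‖ + ‖σ x‖ ≤ c (1 + ‖x‖)` for all `x ∈ ℝ^d`. -/
theorem linear_growth_of_coefficients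
    (d : ℕ) (hd : 0 < d)
    (Θ : Set (EuclideanSpace ℝ (Fin d))) (hΘne : Θ.Nonempty)
    (hΘ : IsCkHypersurface 1 Θ) (hΘreach : 0 < reach Θ)
    (μ : EuclideanSpace ℝ (Fin d) → EuclideanSpace ℝ (Fin d))
    (σ : EuclideanSpace ℝ (Fin d) → EuclideanSpace ℝ (Fin d × Fin d))
    (hbound : ∃ ε : ℝ, 0 < ε ∧ ENNReal.ofReal ε < reach Θ ∧
      ∃ C : ℝ, ∀ x, Metric.infDist x Θ < ε → ‖μ x‖ ≤ C ∧ ‖σ x‖ ≤ C)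
    (hμ : ∃ L : ℝ≥0, IntrinsicLipschitzWith L Θᶜ μ)
    (hσ : ∃ K : ℝ≥0, LipschitzWith K σ) :
    ∃ c : ℝ, 0 < c ∧ ∀ x, ‖μ x‖ + ‖σ x‖ ≤ c * (1 + ‖x‖) := by
  obtain ⟨ε, hε, -, C, hC⟩ := hbound
  obtain ⟨L, hL⟩ := hμ
  obtain ⟨K, hK⟩ := hσ
  obtain ⟨p, hp⟩ := hΘne
  have hC0 : 0 ≤ C := (norm_nonneg _).trans (hC p (by rwa [infDist_zero_of_mem hp])).1
  have hμ_le (x) : ‖μ x‖ ≤ C + L * dist x p := by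
    rcases lt_or_ge (infDist x Θ) ε with hx | hx
    · have := (hC x hx).1
      have : 0 ≤ L * dist x p := by positivity
      linarith
    · obtain ⟨y, hy, hseg, hxy⟩ := exists_infDist_lt_segment_subset_compl ⟨p, hp⟩ hε hx
      have hxy' : dist (μ x) (μ y) ≤ L * dist x y := by
        have h := (hL x (hseg (left_mem_segment ℝ x y)) y (hseg (right_mem_segment ℝ x y))).trans
          (mul_le_mul_right (intrinsicDist_le_edist_of_segment_subset hseg) _)
        simp only [edist_nndist] at h
        exact_mod_cast h
      calc ‖μ x‖ ≤ ‖μ y‖ + dist (μ x) (μ y) := by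
            rw [dist_eq_norm]; exact norm_le_insert' _ _
        _ ≤ C + L * dist x p := by
            gcongr
            · exact (hC y hy).1
            · exact hxy'.trans (by gcongr; exact hxy.trans (infDist_le_dist_of_mem hp))
  have hσ_le (x) : ‖σ x‖ ≤ C + K * dist x p :=
    calc ‖σ x‖ ≤ ‖σ p‖ + dist (σ x) (σ p) := by
          rw [dist_eq_norm]; exact norm_le_insert' _ _
      _ ≤ C + K * dist x p := by
          gcongr
          · exact (hC p (by rwa [infDist_zero_of_mem hp])).2
          · exact hK.dist_le_mul x p
  refine ⟨2 * C + (L + K) * (1 + ‖p‖) + 1, by positivity, fun x => ?_⟩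
  have hxp : dist x p ≤ (1 + ‖p‖) * (1 + ‖x‖) := by
    have := dist_le_norm_add_norm x p
    nlinarith [norm_nonneg x, norm_nonneg p]
  calc ‖μ x‖ + ‖σ x‖ ≤ 2 * C + (L + K) * dist x p := by linarith [hμ_le x, hσ_le x]
    _ ≤ 2 * C * (1 + ‖x‖) + (L + K) * ((1 + ‖p‖) * (1 + ‖x‖)) := by
        refine add_le_add ?_ (by gcongr)
        exact le_mul_of_one_le_right (by positivity) (by linarith [norm_nonneg x])
    _ ≤ (2 * C + (L + K) * (1 + ‖p‖) + 1) * (1 + ‖x‖) := by linarith [norm_nonneg x]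
end

section
/- Let d ∈ ℕ, let M ⊂ ℝ^d be a nonempty C^1-hypersurface, let x ∈ M, let U ⊂ ℝ^d be open with x ∈ U, and let f : U → ℝ be a C^1-function with M ∩ U ⊂ f^{-1}({0}) and f'(x) ≠ 0. Then the tangent cone of M at x equals the kernel of f'(x): T_x(M) = Ker(f'(x)). -/
open Set Metric Filter MeasureTheory
open scoped ENNReal NNReal RealInnerProductSpace ContDiff

theorem fderiv_eq_zero_of_isTangentVector {d : ℕ} {M U : Set (EuclideanSpace ℝ (Fin d))}
    {x v : EuclideanSpace ℝ (Fin d)} {f : EuclideanSpace ℝ (Fin d) → ℝ}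
    (hU : U ∈ nhds x) (hf : DifferentiableAt ℝ f x) (hf0 : ∀ y ∈ M ∩ U, f y = 0)
    (hv : IsTangentVector M x v) : fderiv ℝ f x v = 0 := by
  obtain ⟨ε, hε, γ, hγM, -, rfl, hγ⟩ := hv
  have hzero : f ∘ γ =ᶠ[nhds 0] fun _ => 0 := by
    filter_upwards [hγ.continuousAt hU, Ioo_mem_nhds (neg_lt_zero.mpr hε) hε] with t htU ht
    exact hf0 _ ⟨hγM t ht, htU⟩
  have hcomp := hf.hasFDerivAt.comp_hasDerivAt (0 : ℝ) hγ
  exact hcomp.unique ((hasDerivAt_const (0 : ℝ) (0 : ℝ)).congr_of_eventuallyEq hzero)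

theorem isTangentVector_of_mem_of_contDiffOn {d : ℕ} {M V : Set (EuclideanSpace ℝ (Fin d))}
    {ψ : EuclideanSpace ℝ (Fin d) → EuclideanSpace ℝ (Fin d)} {p w : EuclideanSpace ℝ (Fin d)}
    (hV : IsOpen V) (hp : p ∈ hyperplane d ∩ V) (hψ : ContDiffOn ℝ 1 ψ V)
    (hψM : MapsTo ψ (hyperplane d ∩ V) M) (hw : w ∈ hyperplane d) :
    IsTangentVector M (ψ p) (fderiv ℝ ψ p w) := by
  have hline : ContDiff ℝ 1 fun t : ℝ => p + t • w := by fun_prop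
  have hmem : ∀ᶠ t : ℝ in nhds 0, p + t • w ∈ V :=
    hline.continuous.continuousAt.eventually (hV.mem_nhds (by simpa using hp.2))
  obtain ⟨ε, hε, hball⟩ := Metric.eventually_nhds_iff_ball.mp hmem
  have hIoo : ∀ t ∈ Ioo (-ε) ε, p + t • w ∈ V := fun t ht =>
    hball t (by simpa [Real.ball_eq_Ioo] using ht)
  refine ⟨ε, hε, fun t => ψ (p + t • w), fun t ht => hψM ⟨fun i hi => ?_, hIoo t ht⟩,
    hψ.comp hline.contDiffOn hIoo, by simp, ?_⟩
  · simp [hp.1 i hi, hw i hi]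
  · have hψp : HasFDerivAt ψ (fderiv ℝ ψ p) (p + (0 : ℝ) • w) := by
      simpa using
        ((hψ.contDiffAt (hV.mem_nhds hp.2)).differentiableAt one_ne_zero).hasFDerivAt
    have hl : HasDerivAt (fun t : ℝ => p + t • w) w 0 := by
      simpa using ((hasDerivAt_id (0 : ℝ)).smul_const w).const_add p
    exact hψp.comp_hasDerivAt (0 : ℝ) hl

theorem mem_hyperplane_of_apply_eq_zero {d : ℕ} {g : EuclideanSpace ℝ (Fin d) →L[ℝ] ℝ}
    (hg : g ≠ 0) (hg0 : ∀ w ∈ hyperplane d, g w = 0) {w : EuclideanSpace ℝ (Fin d)}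
    (hw : g w = 0) : w ∈ hyperplane d := by
  intro i hi
  have key : ∀ u : EuclideanSpace ℝ (Fin d), g u = u i * g (EuclideanSpace.single i 1) := by
    intro u
    have hu : u - u i • EuclideanSpace.single i (1 : ℝ) ∈ hyperplane d := by
      intro j hj
      obtain rfl : j = i := Fin.ext (hj.trans hi.symm)
      simp
    simpa [sub_eq_zero] using hg0 _ hu
  refine (mul_eq_zero.mp ((key w).symm.trans hw)).resolve_right fun h => hg ?_
  ext u
  simp [key u, h]

/-- tangent cone = kernel of the derivative of a defining function.
Let `M ⊆ ℝ^d` be a nonempty `C^1`-hypersurface, `x ∈ M`, `U` open with `x ∈ U`, and let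
`f : U → ℝ` be `C^1` on `U` with `M ∩ U ⊆ f⁻¹({0})` and `f'(x) ≠ 0`. Then
`T_x(M) = Ker (f'(x))`. -/
theorem tangentCone_eq_ker_fderiv
    (d : ℕ) (hd : 0 < d)
    (M : Set (EuclideanSpace ℝ (Fin d))) (hMne : M.Nonempty)
    (hM : IsCkHypersurface 1 M)
    (x : EuclideanSpace ℝ (Fin d)) (hx : x ∈ M)
    (U : Set (EuclideanSpace ℝ (Fin d))) (hU : IsOpen U) (hxU : x ∈ U)
    (f : EuclideanSpace ℝ (Fin d) → ℝ)
    (hf : ContDiffOn ℝ 1 f U)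
    (hf0 : ∀ y ∈ M ∩ U, f y = 0)
    (hfx : fderiv ℝ f x ≠ 0) :
    {v | IsTangentVector M x v} = {v | fderiv ℝ f x v = 0} := by
  have hfd : DifferentiableAt ℝ f x :=
    (hf.contDiffAt (hU.mem_nhds hxU)).differentiableAt one_ne_zero
  have hsub : ∀ v, IsTangentVector M x v → fderiv ℝ f x v = 0 := fun _ =>
    fderiv_eq_zero_of_isTangentVector (hU.mem_nhds hxU) hfd hf0
  obtain ⟨W, V, φ, ψ, hW, hV, hxW, hφ, hψ, hφV, -, hψφ, -, himage⟩ := hM x hx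
  have hp : φ x ∈ hyperplane d ∩ V := himage ▸ mem_image_of_mem φ ⟨hx, hxW⟩
  have hψM : MapsTo ψ (hyperplane d ∩ V) M := by
    rw [← himage]
    rintro _ ⟨m, ⟨hmM, hmW⟩, rfl⟩
    rwa [hψφ m hmW]
  have htan : ∀ w ∈ hyperplane d, IsTangentVector M x (fderiv ℝ ψ (φ x) w) := fun w hw => by
    simpa only [hψφ x hxW] using
      isTangentVector_of_mem_of_contDiffOn hV hp (by exact_mod_cast hψ) hψM hw
  have hφd : DifferentiableAt ℝ φ x :=
    (hφ.contDiffAt (hW.mem_nhds hxW)).differentiableAt (by simp)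
  have hψd : DifferentiableAt ℝ ψ (φ x) :=
    (hψ.contDiffAt (hV.mem_nhds hp.2)).differentiableAt (by simp)
  have hinv : ∀ v, fderiv ℝ ψ (φ x) (fderiv ℝ φ x v) = v := by
    have hid : ψ ∘ φ =ᶠ[nhds x] id := by
      filter_upwards [hW.mem_nhds hxW] with y hy using hψφ y hy
    have hcomp := (hψd.hasFDerivAt.comp x hφd.hasFDerivAt).unique
      ((hasFDerivAt_id x).congr_of_eventuallyEq hid)
    exact fun v => DFunLike.congr_fun hcomp v
  refine Subset.antisymm hsub fun v hv => ?_
  have hg : (fderiv ℝ f x).comp (fderiv ℝ ψ (φ x)) ≠ 0 := fun h => hfx <| by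
    ext u
    simpa [hinv u] using DFunLike.congr_fun h (fderiv ℝ φ x u)
  have hmem : fderiv ℝ φ x v ∈ hyperplane d :=
    mem_hyperplane_of_apply_eq_zero hg (fun w hw => hsub _ (htan w hw))
      (by simpa [hinv v] using hv)
  simpa [hinv v] using htan _ hmem
end

section
/- Let d ∈ ℕ, let M ⊂ ℝ^d be a nonempty C^1-hypersurface of positive reach, and let x ∈ M. If u ∈ T_x(M)^⊥ and ‖u‖ < reach(M), then x + u ∈ unp(M) and pr_M(x + u) = x. -/
open Set Metric Filter MeasureTheory
open scoped ENNReal NNReal RealInnerProductSpace ContDiff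

section Reach

open Asymptotics Topology

/-- Nearest points of points close to `y` are close to the unique nearest point of `y`. -/
lemma exists_forall_dist_nearest_lt {E : Type*} [PseudoMetricSpace E] [ProperSpace E]
    {M : Set E} (hM : IsClosed M) {y p : E}
    (hp : ∀ q ∈ M, dist y q = infDist y M → q = p) {η : ℝ} (hη : 0 < η) :
    ∃ c > 0, ∀ z, dist z y < c → ∀ q ∈ M, dist z q = infDist z M → dist q p < η := by
  have key : ∃ c > 0, ∀ q ∈ M, dist y q < infDist y M + 2 * c → dist q p < η := by
    set K : Set E := (M ∩ closedBall y (infDist y M + 2)) \ ball p η with hK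
    have hKc : IsCompact K :=
      ((isCompact_closedBall y _).inter_left hM).diff isOpen_ball
    rcases K.eq_empty_or_nonempty with h | h
    · refine ⟨1, one_pos, fun q hq hd => ?_⟩
      by_contra hc
      have : q ∈ K := ⟨⟨hq, by rw [mem_closedBall, dist_comm]; linarith⟩, hc⟩
      simp [h] at this
    · obtain ⟨q₀, hq₀, hmin⟩ :=
        hKc.exists_isMinOn h (continuous_const.dist continuous_id).continuousOn (f := dist y)
      have hlt : infDist y M < dist y q₀ := by
        refine lt_of_le_of_ne (infDist_le_dist_of_mem hq₀.1.1) fun he => hq₀.2 ?_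
        rw [hp q₀ hq₀.1.1 he.symm]
        exact mem_ball_self hη
      refine ⟨min 1 ((dist y q₀ - infDist y M) / 2), lt_min one_pos (by linarith),
        fun q hq hd => ?_⟩
      have h1 := min_le_left 1 ((dist y q₀ - infDist y M) / 2)
      have h2 := min_le_right 1 ((dist y q₀ - infDist y M) / 2)
      by_contra hc
      have hqK : q ∈ K := ⟨⟨hq, by rw [mem_closedBall, dist_comm]; linarith⟩, hc⟩
      have := isMinOn_iff.1 hmin q hqK
      linarith
  obtain ⟨c, hc, h⟩ := key
  refine ⟨c, hc, fun z hz q hq hzq => h q hq ?_⟩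
  have h1 := dist_triangle y z q
  have h2 := infDist_le_infDist_add_dist (s := M) (x := z) (y := y)
  rw [dist_comm y z] at h1
  linarith

variable {E : Type*} [NormedAddCommGroup E] [InnerProductSpace ℝ E] [ProperSpace E] {M : Set E}

/-- Off `M`, the distance to `M` grows at a rate arbitrarily close to one in some direction. -/
lemma exists_infDist_growth (hM : IsClosed M) {y p : E} (hpM : p ∈ M)
    (hyp : dist y p = infDist y M) (hp : ∀ q ∈ M, dist y q = infDist y M → q = p)
    (hy : 0 < infDist y M) {δ r : ℝ} (hδ : 0 < δ) (hδ1 : δ < 1) (hr : 0 < r) :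
    ∃ z, z ≠ y ∧ dist z y < r ∧ infDist y M + (1 - δ) * dist z y ≤ infDist z M := by
  set ρ := infDist y M with hρ
  obtain ⟨c, hc, hcl⟩ := exists_forall_dist_nearest_lt hM hp (η := δ * ρ / 2) (by positivity)
  obtain ⟨h, h0, hh⟩ := exists_between (lt_min hc hr)
  set n : E := ρ⁻¹ • (y - p) with hn
  have hyp' : ‖y - p‖ = ρ := by rw [← dist_eq_norm, hyp]
  have hn1 : ‖n‖ = 1 := by
    rw [hn, norm_smul, hyp', norm_inv, Real.norm_of_nonneg hy.le, inv_mul_cancel₀ hy.ne']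
  have hd : dist (y + h • n) y = h := by
    rw [dist_eq_norm, add_sub_cancel_left, norm_smul, hn1, mul_one, Real.norm_of_nonneg h0.le]
  obtain ⟨q, hq, hzq⟩ := hM.exists_infDist_eq_dist ⟨p, hpM⟩ (y + h • n)
  have hqp := hcl _ (by rw [hd]; exact hh.trans_le (min_le_left _ _)) q hq hzq.symm
  refine ⟨y + h • n, fun he => ?_, by rw [hd]; exact hh.trans_le (min_le_right _ _), ?_⟩
  · rw [he, dist_self] at hd; exact h0.ne hd
  have hin : ρ - δ * ρ / 2 ≤ ⟪n, y - q⟫ := by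
    have e : y - q = (y - p) - (q - p) := by abel
    have h1 : ⟪n, y - p⟫ = ρ := by
      rw [hn, real_inner_smul_left, real_inner_self_eq_norm_sq, hyp']
      field_simp
    have h2 := real_inner_le_norm n (q - p)
    rw [hn1, one_mul, ← dist_eq_norm] at h2
    rw [e, inner_sub_right, h1]
    linarith
  have hyq : ρ ≤ ‖y - q‖ := by rw [← dist_eq_norm]; exact infDist_le_dist_of_mem hq
  have hsq : infDist (y + h • n) M ^ 2 = ‖y - q‖ ^ 2 + 2 * h * ⟪n, y - q⟫ + h ^ 2 := by
    rw [hzq, dist_eq_norm, show y + h • n - q = (y - q) + h • n by abel, norm_add_sq_real,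
      norm_smul, hn1, real_inner_smul_right, real_inner_comm, Real.norm_of_nonneg h0.le]
    ring
  rw [hd]
  refine le_of_sq_le_sq ?_ infDist_nonneg
  rw [hsq]
  have h1 : ρ ^ 2 ≤ ‖y - q‖ ^ 2 := by gcongr
  have h2 : h * (ρ - δ * ρ / 2) ≤ h * ⟪n, y - q⟫ := by gcongr
  have h3 : (1 - δ) ^ 2 * h ^ 2 ≤ 1 * h ^ 2 := by gcongr; nlinarith
  have h4 : 0 < h * δ * ρ := by positivity
  nlinarith

/-- If nearest points are unique up to distance `ε`, then the distance to `M` attains on a ball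
the largest value allowed by its Lipschitz constant. -/
lemma exists_infDist_add_le (hM : IsClosed M) (hne : M.Nonempty) {ε : ℝ}
    (huniq : ∀ y, infDist y M < ε → ∀ p ∈ M, ∀ q ∈ M,
      dist y p = infDist y M → dist y q = infDist y M → q = p)
    {y : E} {t : ℝ} (hy : 0 < infDist y M) (ht : 0 ≤ t) (hyt : infDist y M + t < ε) :
    ∃ z, dist z y ≤ t ∧ infDist y M + t ≤ infDist z M := by
  have hcont : Continuous fun z : E => infDist z M := continuous_infDist_pt M
  have approx : ∀ δ : ℝ, 0 < δ → δ < 1 →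
      ∃ z ∈ closedBall y t, infDist y M + (1 - δ) * t ≤ infDist z M := by
    intro δ hδ hδ1
    set S : Set E := closedBall y t ∩ {z | infDist y M + (1 - δ) * dist z y ≤ infDist z M} with hS
    have hSc : IsCompact S := (isCompact_closedBall y t).inter_right
      (isClosed_le (by fun_prop) hcont)
    obtain ⟨z, hz, hmax⟩ := hSc.exists_isMaxOn ⟨y, by simp [hS, ht]⟩ hcont.continuousOn
    refine ⟨z, hz.1, ?_⟩
    have hzt : dist z y ≤ t := hz.1
    have hz2 : infDist y M + (1 - δ) * dist z y ≤ infDist z M := hz.2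
    rcases hzt.eq_or_lt with he | hlt
    · rwa [he] at hz2
    exfalso
    have hzpos : infDist y M ≤ infDist z M := by
      nlinarith [dist_nonneg (x := z) (y := y)]
    have hzε : infDist z M < ε := by
      linarith [infDist_le_infDist_add_dist (s := M) (x := z) (y := y)]
    obtain ⟨p, hp, hzp⟩ := hM.exists_infDist_eq_dist hne z
    obtain ⟨w, hwz, hwr, hw⟩ := exists_infDist_growth hM hp hzp.symm
      (fun q hq h => huniq z hzε p hp q hq hzp.symm h) (hy.trans_le hzpos) hδ hδ1
      (sub_pos.2 hlt)
    have hwzpos : 0 < dist w z := dist_pos.2 hwz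
    have htri := dist_triangle w z y
    have hwS : w ∈ S := by
      refine ⟨?_, ?_⟩
      · rw [mem_closedBall]; linarith
      · show infDist y M + (1 - δ) * dist w y ≤ infDist w M
        nlinarith
    have := isMaxOn_iff.1 hmax w hwS
    nlinarith
  obtain ⟨z, hz, hmax⟩ := (isCompact_closedBall y t).exists_isMaxOn
    ⟨y, mem_closedBall_self ht⟩ hcont.continuousOn
  refine ⟨z, hz, le_of_forall_pos_lt_add fun η hη => ?_⟩
  obtain ⟨δ, hδ, hδ'⟩ := exists_between (lt_min one_pos (div_pos hη (by linarith : 0 < t + 1)))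
  obtain ⟨w, hw, hw'⟩ := approx δ hδ (hδ'.trans_le (min_le_left _ _))
  have h1 := isMaxOn_iff.1 hmax w hw
  have h2 := (lt_div_iff₀ (by linarith : 0 < t + 1)).1 (hδ'.trans_le (min_le_right _ _))
  nlinarith

/-- If nearest points are unique up to distance `ε`, then a point `p` that is nearest to some
point of a ray issuing from `p` is nearest to all the points of the ray up to distance `ε`. -/
lemma infDist_ray_eq (hM : IsClosed M) {ε : ℝ}
    (huniq : ∀ y, infDist y M < ε → ∀ p ∈ M, ∀ q ∈ M,
      dist y p = infDist y M → dist y q = infDist y M → q = p)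
    {p n : E} (hp : p ∈ M) (hn : ‖n‖ = 1) {a s : ℝ} (ha : 0 < a)
    (hpa : infDist (p + a • n) M = a) (has : a ≤ s) (hs : s < ε) :
    infDist (p + s • n) M = s := by
  obtain ⟨z, hz, hz'⟩ := exists_infDist_add_le hM ⟨p, hp⟩ huniq (y := p + a • n) (t := s - a)
    (by rwa [hpa]) (by linarith) (by rw [hpa]; linarith)
  rw [hpa] at hz'
  have hzp : s ≤ ‖z - p‖ := by
    rw [← dist_eq_norm]; exact le_trans (by linarith) (infDist_le_dist_of_mem hp)
  obtain ⟨w, rfl⟩ : ∃ w, z = p + a • n + w := ⟨z - (p + a • n), by abel⟩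
  rw [dist_eq_norm, add_sub_cancel_left] at hz
  rw [show p + a • n + w - p = w + a • n by abel] at hzp
  have h1 : s ^ 2 ≤ ‖w‖ ^ 2 + 2 * (a * ⟪w, n⟫) + a ^ 2 := by
    have : ‖w + a • n‖ ^ 2 = ‖w‖ ^ 2 + 2 * (a * ⟪w, n⟫) + a ^ 2 := by
      rw [norm_add_sq_real, norm_smul, hn, real_inner_smul_right, mul_one, Real.norm_eq_abs,
        sq_abs]
    rw [← this]
    gcongr
    linarith
  have h2 : ‖w‖ ^ 2 ≤ (s - a) ^ 2 := by gcongr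
  have h3 : s - a ≤ ⟪w, n⟫ := by
    have : a * (s - a) ≤ a * ⟪w, n⟫ := by nlinarith
    exact le_of_mul_le_mul_left this ha
  have h4 : ‖w - (s - a) • n‖ ^ 2 ≤ 0 := by
    rw [norm_sub_sq_real, norm_smul, hn, real_inner_smul_right, mul_one, Real.norm_eq_abs, sq_abs]
    nlinarith
  have h5 : w = (s - a) • n := by
    rw [← sub_eq_zero, ← norm_eq_zero]
    exact pow_eq_zero_iff two_ne_zero |>.1 (le_antisymm h4 (sq_nonneg _))
  have h6 : p + a • n + w = p + s • n := by rw [h5]; module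
  rw [h6] at hz'
  refine le_antisymm ?_ (by linarith)
  refine (infDist_le_dist_of_mem hp).trans_eq ?_
  rw [dist_eq_norm, add_sub_cancel_left, norm_smul, hn, mul_one, Real.norm_of_nonneg (by linarith)]

/-- If nearest points are unique up to distance `ε` and `u` is orthogonal to `M` at `x` to first
order, then `x` is a nearest point to `x + u` as soon as `‖u‖ < ε`. -/
lemma infDist_add_eq_norm (hM : IsClosed M) {ε : ℝ}
    (huniq : ∀ y, infDist y M < ε → ∀ p ∈ M, ∀ q ∈ M,
      dist y p = infDist y M → dist y q = infDist y M → q = p)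
    {x u : E} (hx : x ∈ M) (hu : (fun p => ⟪u, p - x⟫) =o[𝓝[M] x] fun p => p - x)
    (huε : ‖u‖ < ε) : infDist (x + u) M = ‖u‖ := by
  rcases eq_or_ne u 0 with rfl | hu0
  · simpa using infDist_zero_of_mem hx
  have hs : 0 < ‖u‖ := norm_pos_iff.2 hu0
  choose p hpM hp using fun t : ℝ => hM.exists_infDist_eq_dist ⟨x, hx⟩ (x + t • u)
  have hρ : ∀ t : ℝ, 0 < t → ‖x + t • u - p t‖ ≤ t * ‖u‖ := by
    intro t ht
    rw [← dist_eq_norm, ← hp]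
    refine (infDist_le_dist_of_mem hx).trans_eq ?_
    rw [dist_eq_norm, add_sub_cancel_left, norm_smul, Real.norm_of_nonneg ht.le]
  have hpx : ∀ t : ℝ, 0 < t → ‖p t - x‖ ≤ 2 * (t * ‖u‖) := by
    intro t ht
    have h1 : p t - x = t • u - (x + t • u - p t) := by abel
    have h2 := norm_sub_le (t • u) (x + t • u - p t)
    rw [← h1, norm_smul, Real.norm_of_nonneg ht.le] at h2
    linarith [hρ t ht]
  have hpt : Tendsto p (𝓝[>] 0) (𝓝 x) := by
    rw [tendsto_iff_norm_sub_tendsto_zero]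
    refine squeeze_zero' (.of_forall fun _ => norm_nonneg _)
      (eventually_mem_nhdsWithin.mono fun t ht => hpx t ht) ?_
    have : Tendsto (fun t : ℝ => 2 * (t * ‖u‖)) (𝓝 0) (𝓝 (2 * (0 * ‖u‖))) :=
      Continuous.tendsto (by fun_prop) 0
    simpa using this.mono_left nhdsWithin_le_nhds
  have hptM : Tendsto p (𝓝[>] 0) (𝓝[M] x) :=
    tendsto_nhdsWithin_iff.2 ⟨hpt, .of_forall hpM⟩
  set n : ℝ → E := fun t => ‖x + t • u - p t‖⁻¹ • (x + t • u - p t) with hn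
  -- The directions `n t` make an arbitrarily small angle with `u`.
  have hclose : ∀ η : ℝ, 0 < η → η < 1 → ∀ᶠ t in 𝓝[>] (0 : ℝ),
      0 < ‖x + t • u - p t‖ ∧ ‖u‖ * (1 - η) ≤ ⟪u, n t⟫ := by
    intro η hη hη1
    filter_upwards [(hu.comp_tendsto hptM).bound (show 0 < η * ‖u‖ / 2 by positivity),
      self_mem_nhdsWithin] with t hb ht
    have ht : 0 < t := ht
    simp only [Function.comp_apply, Real.norm_eq_abs] at hb
    have hb' : ⟪u, p t - x⟫ ≤ η * (t * ‖u‖ ^ 2) := by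
      calc ⟪u, p t - x⟫ ≤ η * ‖u‖ / 2 * ‖p t - x‖ := (le_abs_self _).trans hb
        _ ≤ η * ‖u‖ / 2 * (2 * (t * ‖u‖)) := by gcongr; exact hpx t ht
        _ = η * (t * ‖u‖ ^ 2) := by ring
    have hin : (1 - η) * (t * ‖u‖ ^ 2) ≤ ⟪u, x + t • u - p t⟫ := by
      rw [show x + t • u - p t = t • u - (p t - x) by abel, inner_sub_right,
        real_inner_smul_right, real_inner_self_eq_norm_sq]
      linarith
    have h1η : 0 < 1 - η := by linarith
    have hpos : 0 < ‖x + t • u - p t‖ := by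
      have h1 : 0 < (1 - η) * (t * ‖u‖ ^ 2) := by positivity
      refine norm_pos_iff.2 fun h0 => ?_
      rw [h0, inner_zero_right] at hin
      linarith
    refine ⟨hpos, ?_⟩
    rw [hn, real_inner_smul_right, inv_mul_eq_div, le_div_iff₀ hpos]
    refine le_trans ?_ hin
    calc ‖u‖ * (1 - η) * ‖x + t • u - p t‖ ≤ ‖u‖ * (1 - η) * (t * ‖u‖) := by
          gcongr; exact hρ t ht
      _ = _ := by ring
  have hn1 : ∀ t, 0 < ‖x + t • u - p t‖ → ‖n t‖ = 1 := fun t ht => by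
    rw [hn, norm_smul, norm_inv, norm_norm, inv_mul_cancel₀ ht.ne']
  have hsn : Tendsto (fun t => ‖u‖ • n t) (𝓝[>] 0) (𝓝 u) := by
    rw [Metric.tendsto_nhds]
    intro r hr
    obtain ⟨η, hη, hη'⟩ := exists_between
      (lt_min one_pos (show 0 < r ^ 2 / (2 * ‖u‖ ^ 2) by positivity))
    filter_upwards [hclose η hη (hη'.trans_le (min_le_left _ _))] with t ⟨ht, hin⟩
    have h2 := (lt_div_iff₀ (by positivity)).1 (hη'.trans_le (min_le_right _ _))
    rw [dist_eq_norm]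
    refine lt_of_pow_lt_pow_left₀ 2 hr.le ?_
    rw [norm_sub_sq_real, norm_smul, hn1 t ht, norm_norm, mul_one, real_inner_smul_left,
      real_inner_comm]
    nlinarith
  have hev : ∀ᶠ t in 𝓝[>] (0 : ℝ), infDist (p t + ‖u‖ • n t) M = ‖u‖ := by
    have hlt : ∀ᶠ t in 𝓝[>] (0 : ℝ), t < 1 := nhdsWithin_le_nhds (eventually_lt_nhds one_pos)
    filter_upwards [hclose (1 / 2) (by norm_num) (by norm_num), hlt, self_mem_nhdsWithin]
      with t ht ht1 ht0
    have e : p t + ‖x + t • u - p t‖ • n t = x + t • u := by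
      rw [hn, smul_smul, mul_inv_cancel₀ ht.1.ne', one_smul]
      abel
    refine infDist_ray_eq hM huniq (hpM t) (hn1 t ht.1) ht.1 ?_ ?_ huε
    · rw [e, hp, dist_eq_norm]
    · refine (hρ t ht0).trans ?_
      nlinarith
  exact tendsto_nhds_unique (((continuous_infDist_pt M).tendsto _).comp (hpt.add hsn))
    (tendsto_const_nhds.congr' (hev.mono fun _ h => h.symm))

lemma hyperplane_combination {d : ℕ} {z w : EuclideanSpace ℝ (Fin d)} (hz : z ∈ hyperplane d)
    (hw : w ∈ hyperplane d) (t : ℝ) : z + t • (w - z) ∈ hyperplane d := fun i hi => by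
  simp [hz i hi, hw i hi]

/-- A vector orthogonal to the tangent space of a `C¹`-hypersurface at `x` is orthogonal to the
secants through `x` to first order. -/
lemma IsCkHypersurface.isLittleO_inner {d : ℕ} {M : Set (EuclideanSpace ℝ (Fin d))}
    (hM : IsCkHypersurface 1 M) {x u : EuclideanSpace ℝ (Fin d)} (hx : x ∈ M)
    (hu : ∀ v, IsTangentVector M x v → ⟪u, v⟫ = 0) :
    (fun p => ⟪u, p - x⟫) =o[𝓝[M] x] fun p => p - x := by
  obtain ⟨U, V, φ, ψ, hU, hV, hxU, hφ, hψ, hUV, hVU, hψφ, hφψ, himg⟩ := hM x hx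
  have hzV : φ x ∈ V := hUV hxU
  have hφd : DifferentiableAt ℝ φ x :=
    (hφ.differentiableOn (by simp)).differentiableAt (hU.mem_nhds hxU)
  have hψd : DifferentiableAt ℝ ψ (φ x) :=
    (hψ.differentiableOn (by simp)).differentiableAt (hV.mem_nhds hzV)
  have hmem : ∀ q ∈ M, q ∈ U → φ q ∈ hyperplane d := fun q hq hqU =>
    (himg.subset ⟨q, ⟨hq, hqU⟩, rfl⟩).1
  have horth : ∀ q ∈ M, q ∈ U → ⟪u, fderiv ℝ ψ (φ x) (φ q - φ x)⟫ = 0 := by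
    intro q hq hqU
    set l : ℝ → EuclideanSpace ℝ (Fin d) := fun t => φ x + t • (φ q - φ x) with hl
    have hl0 : l 0 = φ x := by simp [hl]
    have hlc : ContDiff ℝ 1 l := by fun_prop
    obtain ⟨ε, hε, hball⟩ := Metric.mem_nhds_iff.1
      (hlc.continuous.continuousAt.preimage_mem_nhds (x := 0) (hV.mem_nhds (hl0 ▸ hzV)))
    have hlV : MapsTo l (Ioo (-ε) ε) V := fun t ht => hball (by
      rw [Real.ball_eq_Ioo]; simpa using ht)
    refine hu _ ⟨ε, hε, ψ ∘ l, fun t ht => ?_, hψ.comp hlc.contDiffOn hlV, ?_, ?_⟩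
    · obtain ⟨m, ⟨hm, hmU⟩, hme⟩ := himg.superset
        ⟨hyperplane_combination (hmem x hx hxU) (hmem q hq hqU) t, hlV ht⟩
      have : (ψ ∘ l) t = m := by
        rw [Function.comp_apply, ← hψφ m hmU, hme]
      rwa [this]
    · simp [hl, hψφ x hxU]
    · have hld : HasDerivAt l (φ q - φ x) 0 := by
        simpa [hl] using ((hasDerivAt_id (0 : ℝ)).smul_const (φ q - φ x)).const_add (φ x)
      have h : HasFDerivAt ψ (fderiv ℝ ψ (φ x)) (l 0) := by rw [hl0]; exact hψd.hasFDerivAt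
      exact h.comp_hasDerivAt 0 hld
  have hO : (fun p => φ p - φ x) =O[𝓝 x] fun p => p - x := hφd.hasFDerivAt.isBigO_sub
  have ho : (fun p => ψ (φ p) - ψ (φ x) - fderiv ℝ ψ (φ x) (φ p - φ x)) =o[𝓝 x]
      fun p => p - x :=
    (hψd.hasFDerivAt.isLittleO.comp_tendsto hφd.continuousAt).trans_isBigO hO
  have ho' := ((innerSL ℝ u).isBigO_comp _ _).trans_isLittleO ho
  refine (ho'.mono nhdsWithin_le_nhds).congr' ?_ .rfl
  filter_upwards [self_mem_nhdsWithin, nhdsWithin_le_nhds (hU.mem_nhds hxU)] with q hq hqU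
  simp only [innerSL_apply_apply, hψφ q hqU, hψφ x hxU]
  rw [inner_sub_right, horth q hq hqU, sub_zero]

end Reach

/-- foot points along normal directions. Let `M ⊆ ℝ^d` be a nonempty
`C^1`-hypersurface of positive reach and `x ∈ M`. If `u ∈ T_x(M)^⊥` and
`‖u‖ < reach M`, then `x + u ∈ unp M` and `pr_M (x + u) = x`. -/
theorem proj_of_normal_displacement
    (d : ℕ) (hd : 0 < d)
    (M : Set (EuclideanSpace ℝ (Fin d))) (hMne : M.Nonempty)
    (hM : IsCkHypersurface 1 M) (hMreach : 0 < reach M)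
    (x : EuclideanSpace ℝ (Fin d)) (hx : x ∈ M)
    (u : EuclideanSpace ℝ (Fin d))
    (hu : ∀ v, IsTangentVector M x v → ⟪u, v⟫ = 0)
    (hsmall : ENNReal.ofReal ‖u‖ < reach M) :
    (x + u) ∈ unp M ∧ IsNearestPt M (x + u) x := by
  obtain ⟨r, ⟨ε, hε, rfl, hsub⟩, hlt⟩ := lt_sSup_iff.1 hsmall
  have huε : ‖u‖ < ε := (ENNReal.ofReal_lt_ofReal_iff_of_nonneg (norm_nonneg u)).1 hlt
  have hεpos : 0 < ε := (norm_nonneg u).trans_lt huε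
  have hclosed : IsClosed M := by
    refine isClosed_of_closure_subset fun y hy => ?_
    have h0 : infDist y M = 0 := (mem_closure_iff_infDist_zero hMne).1 hy
    obtain ⟨p, ⟨hp, hyp⟩, -⟩ := hsub (show infDist y M < ε by rwa [h0])
    rw [h0, dist_eq_zero] at hyp
    rwa [hyp]
  have huniq : ∀ y, infDist y M < ε → ∀ p ∈ M, ∀ q ∈ M,
      dist y p = infDist y M → dist y q = infDist y M → q = p :=
    fun y hy p hp q hq hyp hyq => (hsub hy).unique ⟨hq, hyq⟩ ⟨hp, hyp⟩
  have hdist := infDist_add_eq_norm hclosed huniq hx (hM.isLittleO_inner hx hu) huε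
  refine ⟨hsub (show infDist (x + u) M < ε by rwa [hdist]), hx, ?_⟩
  rw [hdist, dist_eq_norm, add_sub_cancel_left]
end

section
/- Let d ∈ ℕ and let M ⊂ ℝ^d be nonempty. Then for every x ∈ unp(M), the vector x − pr_M(x) is orthogonal to every tangent vector to M at pr_M(x), i.e. x − pr_M(x) ∈ T_{pr_M(x)}(M)^⊥. -/
open Set Metric Filter MeasureTheory
open scoped ENNReal NNReal RealInnerProductSpace ContDiff

/-- At a nearest point of `M` to `x`, the direction to `x` is orthogonal to the velocity of
every curve that stays in `M` near that point. -/
theorem IsNearestPt.inner_eq_zero_of_hasDerivAt {d : ℕ} {M : Set (EuclideanSpace ℝ (Fin d))}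
    {x v : EuclideanSpace ℝ (Fin d)} {γ : ℝ → EuclideanSpace ℝ (Fin d)} {t : ℝ}
    (hp : IsNearestPt M x (γ t)) (hγM : ∀ᶠ s in nhds t, γ s ∈ M) (hγ : HasDerivAt γ v t) :
    ⟪x - γ t, v⟫ = 0 := by
  have hmin : IsLocalMin (fun s => ‖x - γ s‖ ^ 2) t := by
    filter_upwards [hγM] with s hs
    have h : dist x (γ t) ≤ dist x (γ s) := hp.2.trans_le (Metric.infDist_le_dist_of_mem hs)
    rw [dist_eq_norm, dist_eq_norm] at h
    gcongr
  have h := hmin.hasDerivAt_eq_zero (hγ.const_sub x).norm_sq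
  rw [inner_neg_right] at h
  linarith

/-- orthogonality of the projection direction. Let `M ⊆ ℝ^d` be
nonempty. Then for every `x ∈ unp M` with nearest point `p = pr_M x` in `M`, the
vector `x - p` is orthogonal to every tangent vector to `M` at `p`. -/
theorem proj_direction_orthogonal_to_tangents
    (d : ℕ)
    (M : Set (EuclideanSpace ℝ (Fin d))) (hMne : M.Nonempty) :
    ∀ x ∈ unp M, ∀ p, IsNearestPt M x p →
      ∀ v, IsTangentVector M p v → ⟪x - p, v⟫ = 0 := by
  rintro x - p hp v ⟨ε, hε, γ, hγM, -, rfl, hγ⟩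
  refine hp.inner_eq_zero_of_hasDerivAt ?_ hγ
  filter_upwards [Ioo_mem_nhds (neg_lt_zero.mpr hε) hε] using hγM
end

section
/- Let d ∈ ℕ and let M ⊂ ℝ^d be a nonempty connected C^1-hypersurface. Then M has either no normal vector or exactly two normal vectors; more precisely, if 𝔫 is a normal vector along M then the set of all normal vectors along M equals {𝔫, −𝔫}. -/
open Set Metric Filter MeasureTheory
open scoped ENNReal NNReal RealInnerProductSpace ContDiff

/-- Velocities of coordinate curves of a straightening chart are tangent vectors. -/
lemma isTangentVector_of_chart {d : ℕ} {M U V : Set (EuclideanSpace ℝ (Fin d))}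
    {φ ψ : EuclideanSpace ℝ (Fin d) → EuclideanSpace ℝ (Fin d)}
    (hV : IsOpen V) (hψ : ContDiffOn ℝ 1 ψ V) (hψφ : ∀ y ∈ U, ψ (φ y) = y)
    (himg : φ '' (M ∩ U) = hyperplane d ∩ V) {x : EuclideanSpace ℝ (Fin d)}
    (hx : x ∈ M ∩ U) {w : EuclideanSpace ℝ (Fin d)} (hw : w ∈ hyperplane d) :
    IsTangentVector M x (fderiv ℝ ψ (φ x) w) := by
  have hφx : φ x ∈ hyperplane d ∩ V := himg ▸ mem_image_of_mem φ hx
  have hline : ContDiff ℝ 1 fun t : ℝ => φ x + t • w := by fun_prop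
  have hnhds : (fun t : ℝ => φ x + t • w) ⁻¹' V ∈ nhds (0 : ℝ) :=
    (hV.preimage hline.continuous).mem_nhds (by simpa using hφx.2)
  obtain ⟨ε, hε, hball⟩ := Metric.mem_nhds_iff.1 hnhds
  rw [Real.ball_eq_Ioo, zero_sub, zero_add] at hball
  refine ⟨ε, hε, fun t => ψ (φ x + t • w), fun t ht => ?_,
    hψ.comp hline.contDiffOn hball, by simp [hψφ x hx.2], ?_⟩
  · have hmem : φ x + t • w ∈ hyperplane d ∩ V :=
      ⟨fun i hi => by simp [hφx.1 i hi, hw i hi], hball ht⟩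
    rw [← himg] at hmem
    obtain ⟨y, hy, hyt⟩ := hmem
    simpa only [← hyt, hψφ y hy.2] using hy.1
  · have hd : HasFDerivAt ψ (fderiv ℝ ψ (φ x)) (φ x + (0 : ℝ) • w) := by
      simpa using ((hψ.contDiffAt (hV.mem_nhds hφx.2)).differentiableAt one_ne_zero).hasFDerivAt
    have hl : HasDerivAt (fun t : ℝ => φ x + t • w) w 0 := by
      simpa using ((hasDerivAt_id (0 : ℝ)).smul_const w).const_add (φ x)
    exact hd.comp_hasDerivAt (0 : ℝ) hl

/-- At each point of a `C^1`-hypersurface, the vectors orthogonal to all tangent vectors are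
multiples of a single vector. -/
lemma IsCkHypersurface.exists_normal_line {d : ℕ} (hd : 0 < d)
    {M : Set (EuclideanSpace ℝ (Fin d))} (hM : IsCkHypersurface 1 M)
    {x : EuclideanSpace ℝ (Fin d)} (hx : x ∈ M) :
    ∃ g : EuclideanSpace ℝ (Fin d), ∀ a : EuclideanSpace ℝ (Fin d),
      (∀ v, IsTangentVector M x v → ⟪a, v⟫ = 0) → ∃ c : ℝ, a = c • g := by
  obtain ⟨U, V, φ, ψ, hU, hV, hxU, hφ, hψ, hUV, -, hψφ, -, himg⟩ := hM x hx
  let i : Fin d := ⟨d - 1, by omega⟩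
  let e : EuclideanSpace ℝ (Fin d) := EuclideanSpace.single i 1
  set A := fderiv ℝ ψ (φ x) with hA
  set B := fderiv ℝ φ x with hB
  have hAB : ∀ v, A (B v) = v := by
    have hφ' : HasFDerivAt φ B x :=
      ((hφ.contDiffAt (hU.mem_nhds hxU)).differentiableAt one_ne_zero).hasFDerivAt
    have hψ' : HasFDerivAt ψ A (φ x) :=
      ((hψ.contDiffAt (hV.mem_nhds (hUV hxU))).differentiableAt one_ne_zero).hasFDerivAt
    have hid : HasFDerivAt (fun y => y) (A.comp B) x :=
      (hψ'.comp x hφ').congr_of_eventuallyEq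
        (by filter_upwards [hU.mem_nhds hxU] with y hy using (hψφ y hy).symm)
    intro v
    exact congrArg (fun L => L v) (hid.unique (hasFDerivAt_id x))
  refine ⟨ContinuousLinearMap.adjoint B e, fun a ha => ⟨⟪a, A e⟫, ?_⟩⟩
  refine ext_inner_right ℝ fun v => ?_
  have hw : B v - (B v i) • e ∈ hyperplane d := by
    intro j hj
    obtain rfl : j = i := Fin.ext hj
    simp [e]
  have h := ha _ (isTangentVector_of_chart hV hψ hψφ himg ⟨hx, hxU⟩ hw)
  rw [← hA, map_sub, map_smul, hAB, inner_sub_right, inner_smul_right, sub_eq_zero] at h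
  rw [h, inner_smul_left, ContinuousLinearMap.adjoint_inner_left]
  simp [e, EuclideanSpace.inner_single_left, mul_comm]

/-- Two parallel unit vectors agree up to sign. -/
lemma eq_or_eq_neg_of_norm_eq_one_of_smul {E : Type*} [NormedAddCommGroup E] [NormedSpace ℝ E]
    {a b g : E} (ha : ‖a‖ = 1) (hb : ‖b‖ = 1) (hag : ∃ c : ℝ, a = c • g)
    (hbg : ∃ c : ℝ, b = c • g) : b = a ∨ b = -a := by
  obtain ⟨c, rfl⟩ := hag
  obtain ⟨c', rfl⟩ := hbg
  have hg : ‖g‖ ≠ 0 := by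
    intro h
    simp [norm_smul, h] at ha
  rw [norm_smul] at ha hb
  rcases abs_eq_abs.1 (mul_right_cancel₀ hg (hb.trans ha.symm)) with h | h
  · exact Or.inl (by rw [h])
  · exact Or.inr (by rw [h, neg_smul])

/-- a connected hypersurface has at most two normal vectors. Let
`M ⊆ ℝ^d` be a nonempty connected `C^1`-hypersurface and let `n` be a normal vector
along `M`. Then `-n` is also a normal vector along `M`, and every normal vector along
`M` coincides on `M` with `n` or with `-n`; i.e. the set of normal vectors along `M`
is exactly `{n, -n}`. -/
theorem normal_vector_dichotomy
    (d : ℕ) (hd : 0 < d)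
    (M : Set (EuclideanSpace ℝ (Fin d))) (hMne : M.Nonempty)
    (hM : IsCkHypersurface 1 M) (hconn : IsConnected M)
    (n : EuclideanSpace ℝ (Fin d) → EuclideanSpace ℝ (Fin d))
    (hn : IsNormalVector M n) :
    IsNormalVector M (fun x => -(n x)) ∧
      ∀ n' : EuclideanSpace ℝ (Fin d) → EuclideanSpace ℝ (Fin d),
        IsNormalVector M n' →
          (∀ x ∈ M, n' x = n x) ∨ (∀ x ∈ M, n' x = -(n x)) := by
  refine ⟨⟨hn.1.neg, fun x hx => by rw [norm_neg, hn.2.1 x hx], fun x hx v hv => by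
    rw [inner_neg_left, hn.2.2 x hx v hv, neg_zero]⟩, fun n' hn' => ?_⟩
  have hpt : ∀ x ∈ M, n' x = n x ∨ n' x = -(n x) := fun x hx => by
    obtain ⟨g, hg⟩ := hM.exists_normal_line hd hx
    exact eq_or_eq_neg_of_norm_eq_one_of_smul (hn.2.1 x hx) (hn'.2.1 x hx)
      (hg _ (hn.2.2 x hx)) (hg _ (hn'.2.2 x hx))
  have hself : ∀ x ∈ M, ⟪n x, n x⟫ = 1 := fun x hx => by
    rw [real_inner_self_eq_norm_sq, hn.2.1 x hx, one_pow]
  have hsq : EqOn ((fun x => ⟪n x, n' x⟫) ^ 2) 1 M := fun x hx => by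
    rcases hpt x hx with h | h <;> simp [h, hn.2.1 x hx]
  rcases hconn.isPreconnected.eq_one_or_eq_neg_one_of_sq_eq (hn.1.inner hn'.1) hsq with h | h
  · refine Or.inl fun x hx => (hpt x hx).resolve_right fun hneg => ?_
    have h1 : ⟪n x, n' x⟫ = 1 := h hx
    rw [hneg, inner_neg_right, hself x hx] at h1
    norm_num at h1
  · refine Or.inr fun x hx => (hpt x hx).resolve_left fun hpos => ?_
    have h1 : ⟪n x, n' x⟫ = -1 := h hx
    rw [hpos, hself x hx] at h1
    norm_num at h1
end

section
/- Let d, m, k ∈ ℕ, let M ⊂ ℝ^d be nonempty, and let f : ℝ^d → ℝ^{k×m} be continuous on ℝ^d and intrinsic Lipschitz continuous on ℝ^d \ M. Assume that for all x, y ∈ ℝ^d and all ε > 0 there exists a continuous γ : [0,1] → ℝ^d with γ(0) = x, γ(1) = y, l(γ) < ‖x − y‖ + ε, and γ([0,1]) ∩ M finite. Then f is Lipschitz continuous on ℝ^d. -/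
open Set Metric Filter MeasureTheory
open scoped ENNReal NNReal RealInnerProductSpace ContDiff

/-- Along a curve in `A`, an intrinsic Lipschitz function changes by at most the Lipschitz
constant times the length of the curve. -/
theorem IntrinsicLipschitzWith.edist_comp_le {d : ℕ} {F : Type*} [PseudoEMetricSpace F] {L : ℝ≥0}
    {A : Set (EuclideanSpace ℝ (Fin d))} {f : EuclideanSpace ℝ (Fin d) → F}
    (hf : IntrinsicLipschitzWith L A f) {γ : ℝ → EuclideanSpace ℝ (Fin d)} {a b : ℝ} (hab : a ≤ b)
    (hγ : ContinuousOn γ (Icc a b)) (hA : MapsTo γ (Icc a b) A) :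
    edist (f (γ a)) (f (γ b)) ≤ L * eVariationOn γ (Icc a b) := by
  let φ : ℝ → ℝ := fun u => a + u * (b - a)
  have hφ : MapsTo φ (Icc 0 1) (Icc a b) := by
    rintro u ⟨h0, h1⟩
    constructor <;> simp only [φ] <;> nlinarith
  have hmono : MonotoneOn φ (Icc 0 1) := by
    intro u _ v _ huv
    simp only [φ]
    nlinarith
  refine (hf _ (hA (left_mem_Icc.2 hab)) _ (hA (right_mem_Icc.2 hab))).trans ?_
  gcongr
  unfold intrinsicDist
  refine iInf_le_of_le (γ ∘ φ) <| iInf_le_of_le (hγ.comp (by fun_prop) hφ) <|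
    iInf_le_of_le (hA.comp hφ) <| iInf_le_of_le (by simp [φ]) <| iInf_le_of_le (by simp [φ]) ?_
  exact eVariationOn.comp_le_of_monotoneOn γ φ hmono hφ

/-- A continuous function which is intrinsic Lipschitz off `M` changes along a curve meeting `M` in
finitely many points by at most the Lipschitz constant times the length of the curve. -/
theorem IntrinsicLipschitzWith.edist_comp_le_of_finite {d : ℕ} {F : Type*} [PseudoEMetricSpace F]
    {L : ℝ≥0} {M : Set (EuclideanSpace ℝ (Fin d))} {f : EuclideanSpace ℝ (Fin d) → F}
    (hf : IntrinsicLipschitzWith L Mᶜ f) (hcont : Continuous f)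
    {γ : ℝ → EuclideanSpace ℝ (Fin d)} {a b : ℝ} (hab : a ≤ b) (hγ : ContinuousOn γ (Icc a b))
    (hfin : (γ '' Icc a b ∩ M).Finite) :
    edist (f (γ a)) (f (γ b)) ≤ L * eVariationOn γ (Icc a b) := by
  suffices H : ∀ S : Set (EuclideanSpace ℝ (Fin d)), S.Finite → ∀ a b, a ≤ b →
      ContinuousOn γ (Icc a b) → γ '' Icc a b ∩ M ⊆ S →
      edist (f (γ a)) (f (γ b)) ≤ L * eVariationOn γ (Icc a b) from
    H _ hfin a b hab hγ subset_rfl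
  clear! a b
  intro S hS
  induction S, hS using Set.Finite.induction_on with
  | empty =>
    intro a b hab hγ hM
    refine hf.edist_comp_le hab hγ fun t ht htM => ?_
    exact hM ⟨mem_image_of_mem γ ht, htM⟩
  | @insert p S _ _ ih =>
    intro a b hab hγ hM
    have avoid : ∀ c e, Icc c e ⊆ Icc a b → (∀ t ∈ Icc c e, γ t ≠ p) → γ '' Icc c e ∩ M ⊆ S := by
      rintro c e hsub hp _ ⟨⟨t, ht, rfl⟩, htM⟩
      exact (hM ⟨mem_image_of_mem γ (hsub ht), htM⟩).resolve_left (hp t ht)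
    by_cases hp : ∀ t ∈ Icc a b, γ t ≠ p
    · exact ih a b hab hγ (avoid a b subset_rfl hp)
    push Not at hp
    obtain ⟨t₀, ht₀, hpt₀⟩ := hp
    have hK : IsCompact (Icc a b ∩ γ ⁻¹' {p}) :=
      isCompact_Icc.of_isClosed_subset
        (hγ.preimage_isClosed_of_isClosed isClosed_Icc isClosed_singleton) inter_subset_left
    obtain ⟨s, ⟨hs, hsp⟩, hsle⟩ := hK.exists_isLeast ⟨t₀, ht₀, hpt₀⟩
    obtain ⟨t, ⟨ht, htp⟩, htge⟩ := hK.exists_isGreatest ⟨t₀, ht₀, hpt₀⟩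
    have hst : s ≤ t := hsle ⟨ht, htp⟩
    have hfγ : ContinuousOn (f ∘ γ) (Icc a b) := hcont.comp_continuousOn hγ
    have left : edist (f (γ a)) (f (γ s)) ≤ L * eVariationOn γ (Icc a s) := by
      rcases hs.1.eq_or_lt with rfl | has
      · simp
      have hcl : s ∈ closure (Ico a s) := by
        rw [closure_Ico has.ne]; exact right_mem_Icc.2 hs.1
      refine ContinuousWithinAt.closure_le (f := fun u => edist (f (γ a)) (f (γ u))) hcl
        (tendsto_const_nhds.edist
          ((hfγ s hs).mono (Ico_subset_Icc_self.trans (Icc_subset_Icc_right hs.2))))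
        continuousWithinAt_const fun u hu => ?_
      have hsub : Icc a u ⊆ Icc a b := Icc_subset_Icc_right (hu.2.le.trans hs.2)
      refine (ih a u hu.1 (hγ.mono hsub) (avoid a u hsub fun v hv hvp => ?_)).trans ?_
      · exact (hv.2.trans_lt hu.2).not_ge (hsle ⟨hsub hv, hvp⟩)
      · gcongr
        exact eVariationOn.mono γ (Icc_subset_Icc_right hu.2.le)
    have right : edist (f (γ t)) (f (γ b)) ≤ L * eVariationOn γ (Icc t b) := by
      rcases ht.2.eq_or_lt with rfl | htb
      · simp
      have hcl : t ∈ closure (Ioc t b) := by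
        rw [closure_Ioc htb.ne]; exact left_mem_Icc.2 ht.2
      refine ContinuousWithinAt.closure_le (f := fun u => edist (f (γ u)) (f (γ b))) hcl
        (Tendsto.edist
          ((hfγ t ht).mono (Ioc_subset_Icc_self.trans (Icc_subset_Icc_left ht.1)))
          tendsto_const_nhds)
        continuousWithinAt_const fun u hu => ?_
      have hsub : Icc u b ⊆ Icc a b := Icc_subset_Icc_left (ht.1.trans hu.1.le)
      refine (ih u b hu.2 (hγ.mono hsub) (avoid u b hsub fun v hv hvp => ?_)).trans ?_
      · exact (hu.1.trans_le hv.1).not_ge (htge ⟨hsub hv, hvp⟩)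
      · gcongr
        exact eVariationOn.mono γ (Icc_subset_Icc_left hu.1.le)
    have hloop : γ s = γ t := hsp.trans htp.symm
    calc edist (f (γ a)) (f (γ b))
        ≤ edist (f (γ a)) (f (γ s)) + edist (f (γ t)) (f (γ b)) := by
          rw [hloop]; exact edist_triangle _ _ _
      _ ≤ L * (eVariationOn γ (Icc a s) + eVariationOn γ (Icc t b)) := by
          rw [mul_add]; gcongr
      _ ≤ L * eVariationOn γ (Icc a b) := by
          gcongr
          refine (eVariationOn.add_le_union γ fun x hx y hy => hx.2.trans (hst.trans hy.1)).trans ?_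
          exact eVariationOn.mono γ
            (union_subset (Icc_subset_Icc_right hs.2) (Icc_subset_Icc_left ht.1))

/-- from piecewise intrinsic Lipschitz to global Lipschitz. Let
`M ⊆ ℝ^d` be nonempty and let `f : ℝ^d → ℝ^{k×m}` be continuous on `ℝ^d` and intrinsic
Lipschitz continuous on `ℝ^d \ M`. Assume that any two points `x, y ∈ ℝ^d` can be
joined, for every `ε > 0`, by a continuous curve `γ` of length `< ‖x - y‖ + ε` meeting
`M` in only finitely many points. Then `f` is Lipschitz continuous on `ℝ^d`. -/
theorem lipschitz_of_intrinsicLipschitz_off_exceptional_set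
    (d m k : ℕ) (hd : 0 < d) (hm : 0 < m) (hk : 0 < k)
    (M : Set (EuclideanSpace ℝ (Fin d))) (hMne : M.Nonempty)
    (f : EuclideanSpace ℝ (Fin d) → EuclideanSpace ℝ (Fin k × Fin m))
    (hcont : Continuous f)
    (hlip : ∃ L : ℝ≥0, IntrinsicLipschitzWith L Mᶜ f)
    (hpath : ∀ x y : EuclideanSpace ℝ (Fin d), ∀ ε : ℝ, 0 < ε →
      ∃ γ : ℝ → EuclideanSpace ℝ (Fin d),
        ContinuousOn γ (Set.Icc 0 1) ∧ γ 0 = x ∧ γ 1 = y ∧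
        eVariationOn γ (Set.Icc 0 1) < ENNReal.ofReal (‖x - y‖ + ε) ∧
        ((γ '' Set.Icc 0 1) ∩ M).Finite) :
    ∃ K : ℝ≥0, LipschitzWith K f := by
  obtain ⟨L, hL⟩ := hlip
  refine ⟨L, LipschitzWith.of_dist_le_mul fun x y => ?_⟩
  have key : ∀ ε : ℝ, 0 < ε → dist (f x) (f y) ≤ L * (dist x y + ε) := by
    intro ε hε
    obtain ⟨γ, hγ, rfl, rfl, hlen, hfin⟩ := hpath x y ε hε
    rw [← dist_eq_norm] at hlen
    have hpos : 0 ≤ dist (γ 0) (γ 1) + ε := by positivity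
    have h := (hL.edist_comp_le_of_finite hcont zero_le_one hγ hfin).trans
      (mul_le_mul_right hlen.le _)
    rw [edist_dist, ← ENNReal.ofReal_coe_nnreal, ← ENNReal.ofReal_mul L.coe_nonneg] at h
    exact (ENNReal.ofReal_le_ofReal_iff (by positivity)).1 h
  have hlim : Tendsto (fun ε : ℝ => L * (dist x y + ε)) (nhdsWithin 0 (Ioi 0))
      (nhds (L * dist x y)) := by
    have : Continuous fun ε : ℝ => (L : ℝ) * (dist x y + ε) := by fun_prop
    simpa using (this.tendsto 0).mono_left nhdsWithin_le_nhds
  exact ge_of_tendsto hlim (eventually_nhdsWithin_of_forall fun ε hε => key ε hε)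
end

section
/- Let d, m ∈ ℕ, let B ⊂ ℝ^d and A ⊂ ℝ^m be nonempty and open, let g : B → A be intrinsic Lipschitz continuous with intrinsic Lipschitz constant L_g, and let f : A → ℝ^m be intrinsic Lipschitz continuous with intrinsic Lipschitz constant L_f. Then f ∘ g : B → ℝ^m is intrinsic Lipschitz continuous with intrinsic Lipschitz constant L_f · L_g. -/
open Set Metric Filter MeasureTheory
open scoped ENNReal NNReal RealInnerProductSpace ContDiff

/-- A curve in `A` bounds the intrinsic distance of its endpoints by its variation, whatever the
parameter interval. -/
theorem intrinsicDist_le_eVariationOn {d : ℕ} {A : Set (EuclideanSpace ℝ (Fin d))}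
    {γ : ℝ → EuclideanSpace ℝ (Fin d)} {s t : ℝ} (hst : s ≤ t)
    (hγ : ContinuousOn γ (Icc s t)) (hγA : MapsTo γ (Icc s t) A) :
    intrinsicDist A (γ s) (γ t) ≤ eVariationOn γ (Icc s t) := by
  have hts : 0 ≤ t - s := sub_nonneg.2 hst
  have hmaps : MapsTo (fun u : ℝ => s + u * (t - s)) (Icc 0 1) (Icc s t) := fun u hu =>
    ⟨by nlinarith [mul_nonneg hu.1 hts], by nlinarith [mul_le_mul_of_nonneg_right hu.2 hts]⟩
  have hmono : MonotoneOn (fun u : ℝ => s + u * (t - s)) (Icc 0 1) := fun u _ v _ huv => by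
    dsimp only
    gcongr
  refine le_trans ?_ (eVariationOn.comp_le_of_monotoneOn γ _ hmono hmaps)
  refine iInf_le_of_le (γ ∘ fun u => s + u * (t - s)) ?_
  refine iInf_le_of_le (hγ.comp (by fun_prop) hmaps) ?_
  refine iInf_le_of_le (hγA.comp hmaps) ?_
  exact iInf_le_of_le (by simp) (iInf_le_of_le (by simp) le_rfl)

/-- On a convex subset of `A`, the intrinsic distance is at most the Euclidean distance. -/
theorem intrinsicDist_le_edist {d : ℕ} {A C : Set (EuclideanSpace ℝ (Fin d))}
    (hC : Convex ℝ C) (hCA : C ⊆ A) {x y : EuclideanSpace ℝ (Fin d)} (hx : x ∈ C) (hy : y ∈ C) :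
    intrinsicDist A x y ≤ edist x y := by
  have hlip := (lipschitzWith_lineMap (𝕜 := ℝ) x y).lipschitzOnWith (s := univ)
  have hid : eVariationOn (id : ℝ → ℝ) (Icc 0 1) ≤ 1 := by
    simp
  have hmaps : MapsTo (AffineMap.lineMap x y : ℝ → _) (Icc (0 : ℝ) 1) A :=
    fun u hu => hCA (hC.lineMap_mem hx hy hu)
  have hdist := intrinsicDist_le_eVariationOn zero_le_one
    (AffineMap.lineMap_continuous (p := x) (q := y) (R := ℝ)).continuousOn hmaps
  rw [AffineMap.lineMap_apply_zero, AffineMap.lineMap_apply_one] at hdist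
  calc intrinsicDist A x y
      ≤ eVariationOn (AffineMap.lineMap x y ∘ id) (Icc (0 : ℝ) 1) := hdist
    _ ≤ nndist x y * eVariationOn (id : ℝ → ℝ) (Icc 0 1) :=
        hlip.comp_eVariationOn_le (mapsTo_univ _ _)
    _ ≤ nndist x y * 1 := by gcongr
    _ = edist x y := by rw [mul_one, edist_nndist]

theorem IntrinsicLipschitzWith.continuousOn {d : ℕ} {F : Type*} [PseudoEMetricSpace F] {L : ℝ≥0}
    {A : Set (EuclideanSpace ℝ (Fin d))} {f : EuclideanSpace ℝ (Fin d) → F}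
    (hf : IntrinsicLipschitzWith L A f) (hA : IsOpen A) : ContinuousOn f A := by
  intro x hx
  obtain ⟨r, hr, hball⟩ := Metric.isOpen_iff.1 hA x hx
  have hlip : LipschitzOnWith L f (ball x r) := fun y hy z hz =>
    (hf y (hball hy) z (hball hz)).trans
      (mul_le_mul_right (intrinsicDist_le_edist (convex_ball x r) hball hy hz) _)
  exact (hlip.continuousOn.continuousAt (ball_mem_nhds x hr)).continuousWithinAt

/-- An intrinsic Lipschitz map increases the length of curves at most by its constant. -/
theorem IntrinsicLipschitzWith.eVariationOn_comp_le {d : ℕ} {F : Type*} [PseudoEMetricSpace F]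
    {L : ℝ≥0} {A : Set (EuclideanSpace ℝ (Fin d))} {f : EuclideanSpace ℝ (Fin d) → F}
    (hf : IntrinsicLipschitzWith L A f) {γ : ℝ → EuclideanSpace ℝ (Fin d)} {a b : ℝ}
    (hγ : ContinuousOn γ (Icc a b)) (hγA : MapsTo γ (Icc a b) A) :
    eVariationOn (f ∘ γ) (Icc a b) ≤ L * eVariationOn γ (Icc a b) := by
  refine iSup_le ?_
  rintro ⟨n, u, hu, hmem⟩
  have hsub (i j : ℕ) : Icc (u i) (u j) ⊆ Icc a b := Icc_subset_Icc (hmem i).1 (hmem j).2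
  calc ∑ i ∈ Finset.range n, edist ((f ∘ γ) (u (i + 1))) ((f ∘ γ) (u i))
      ≤ ∑ i ∈ Finset.range n, L * eVariationOn γ (Icc (u i) (u (i + 1))) := by
        refine Finset.sum_le_sum fun i _ => ?_
        rw [edist_comm]
        refine (hf _ (hγA (hmem i)) _ (hγA (hmem (i + 1)))).trans ?_
        gcongr
        exact intrinsicDist_le_eVariationOn (hu i.le_succ) (hγ.mono (hsub _ _))
          (hγA.mono_left (hsub _ _))
    _ = L * eVariationOn γ (Icc (u 0) (u n)) := by
        rw [← Finset.mul_sum, eVariationOn.sum' γ hu]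
    _ ≤ L * eVariationOn γ (Icc a b) := by
        gcongr
        exact eVariationOn.mono γ (hsub _ _)

/-- For a nonzero constant, the intrinsic Lipschitz estimate may be checked curve by curve. -/
theorem le_mul_intrinsicDist {d : ℕ} {A : Set (EuclideanSpace ℝ (Fin d))}
    {x y : EuclideanSpace ℝ (Fin d)} {c : ℝ≥0} (hc : c ≠ 0) {e : ℝ≥0∞}
    (h : ∀ γ : ℝ → EuclideanSpace ℝ (Fin d), ContinuousOn γ (Icc 0 1) → MapsTo γ (Icc 0 1) A →
      γ 0 = x → γ 1 = y → e ≤ c * eVariationOn γ (Icc 0 1)) :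
    e ≤ c * intrinsicDist A x y := by
  have hc' : (c : ℝ≥0∞) ≠ 0 := ENNReal.coe_ne_zero.2 hc
  rw [← ENNReal.div_le_iff' hc' ENNReal.coe_ne_top]
  refine le_iInf fun γ => le_iInf fun hγ => le_iInf fun hγA => le_iInf fun h0 =>
    le_iInf fun h1 => ?_
  exact (ENNReal.div_le_iff' hc' ENNReal.coe_ne_top).2 (h γ hγ hγA h0 h1)

/-- composition of intrinsic Lipschitz maps. Let `B ⊆ ℝ^d` and
`A ⊆ ℝ^m` be nonempty and open, let `g : B → A` be intrinsic Lipschitz with constant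
`L_g`, and let `f : A → ℝ^m` be intrinsic Lipschitz with constant `L_f`. Then
`f ∘ g : B → ℝ^m` is intrinsic Lipschitz with constant `L_f · L_g`. -/
theorem intrinsicLipschitz_comp
    (d m : ℕ)
    (B : Set (EuclideanSpace ℝ (Fin d))) (hBne : B.Nonempty) (hB : IsOpen B)
    (A : Set (EuclideanSpace ℝ (Fin m))) (hAne : A.Nonempty) (hA : IsOpen A)
    (g : EuclideanSpace ℝ (Fin d) → EuclideanSpace ℝ (Fin m))
    (hgA : Set.MapsTo g B A)
    (Lg : ℝ≥0) (hg : IntrinsicLipschitzWith Lg B g)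
    (f : EuclideanSpace ℝ (Fin m) → EuclideanSpace ℝ (Fin m))
    (Lf : ℝ≥0) (hf : IntrinsicLipschitzWith Lf A f) :
    IntrinsicLipschitzWith (Lf * Lg) B (f ∘ g) := by
  intro x hx y hy
  have hfg := hf _ (hgA hx) _ (hgA hy)
  rcases eq_or_ne Lf 0 with rfl | hLf
  · simpa using hfg
  rcases eq_or_ne Lg 0 with rfl | hLg
  · have hgxy : g x = g y := by simpa using hg x hx y hy
    simp [hgxy]
  refine le_mul_intrinsicDist (mul_ne_zero hLf hLg) ?_
  rintro γ hγ hγB rfl rfl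
  calc edist (f (g (γ 0))) (f (g (γ 1)))
      ≤ Lf * intrinsicDist A (g (γ 0)) (g (γ 1)) := hfg
    _ ≤ Lf * eVariationOn (g ∘ γ) (Icc 0 1) := by
        gcongr
        exact intrinsicDist_le_eVariationOn (γ := g ∘ γ) zero_le_one
          ((hg.continuousOn hB).comp hγ hγB) (hgA.comp hγB)
    _ ≤ Lf * (Lg * eVariationOn γ (Icc 0 1)) := by
        gcongr
        exact hg.eVariationOn_comp_le hγ hγB
    _ = (Lf * Lg : ℝ≥0) * eVariationOn γ (Icc 0 1) := by
        rw [ENNReal.coe_mul, mul_assoc]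
end

section
/- Let d ∈ ℕ, let M ⊂ ℝ^d be a nonempty C^1-hypersurface of positive reach, let 𝔫 : M → ℝ^d be a normal vector along M, and let f : ℝ^d → ℝ^d be intrinsic Lipschitz continuous on ℝ^d \ M. Assume that for every x ∈ M the limit lim_{h → 0} f(x + h𝔫(x)) exists and equals f(x). Then f is continuous on ℝ^d. -/
open Set Metric Filter MeasureTheory
open scoped ENNReal NNReal RealInnerProductSpace ContDiff

theorem intrinsicDist_le_of_lipschitzOn_segment {d : ℕ}
    {A T : Set (EuclideanSpace ℝ (Fin d))}
    {ψ : EuclideanSpace ℝ (Fin d) → EuclideanSpace ℝ (Fin d)} {K : ℝ≥0}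
    (hψ : LipschitzOnWith K ψ T) {a b : EuclideanSpace ℝ (Fin d)}
    (hT : ∀ t ∈ Icc (0 : ℝ) 1, AffineMap.lineMap a b t ∈ T)
    (hA : ∀ t ∈ Icc (0 : ℝ) 1, ψ (AffineMap.lineMap a b t) ∈ A) :
    intrinsicDist A (ψ a) (ψ b) ≤ K * edist a b := by
  have hline : LipschitzWith (nndist a b) (AffineMap.lineMap a b : ℝ → EuclideanSpace ℝ (Fin d)) :=
    lipschitzWith_lineMap a b
  have hcomp : LipschitzOnWith (K * nndist a b) (fun t : ℝ => ψ (AffineMap.lineMap a b t))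
      (Icc 0 1) :=
    hψ.comp hline.lipschitzOnWith hT
  have hvar : eVariationOn (fun t : ℝ => ψ (AffineMap.lineMap a b t)) (Icc 0 1)
      ≤ K * edist a b := by
    have h1 := hcomp.comp_eVariationOn_le (g := id) (s := Icc (0 : ℝ) 1) (fun t ht => ht)
    have h2 : eVariationOn (id : ℝ → ℝ) (Icc (0 : ℝ) 1) ≤ 1 := by
      have := (monotone_id.monotoneOn (Icc (0 : ℝ) 1)).eVariationOn_eq
        (left_mem_Icc.2 zero_le_one) (right_mem_Icc.2 zero_le_one)
      rw [inter_self] at this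
      simp [this]
    calc _ ≤ _ := h1
      _ ≤ ((K * nndist a b : ℝ≥0) : ℝ≥0∞) * 1 := by gcongr
      _ = K * edist a b := by rw [mul_one, ENNReal.coe_mul, edist_nndist]
  refine le_trans ?_ hvar
  unfold intrinsicDist
  exact iInf_le_of_le _ (iInf_le_of_le hcomp.continuousOn (iInf_le_of_le hA
    (iInf_le_of_le (by simp) (iInf_le_of_le (by simp) le_rfl))))

theorem isClosed_of_reach_pos {d : ℕ} {M : Set (EuclideanSpace ℝ (Fin d))}
    (hM : M.Nonempty) (hr : 0 < reach M) : IsClosed M := by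
  obtain ⟨r, ⟨ε, -, rfl, hε⟩, hr⟩ := lt_sSup_iff.1 hr
  rw [ENNReal.ofReal_pos] at hr
  refine isClosed_of_closure_subset fun x hx => ?_
  have h0 : infDist x M = 0 := (mem_closure_iff_infDist_zero hM).1 hx
  obtain ⟨p, ⟨hp, hxp⟩, -⟩ := hε (show infDist x M < ε from h0 ▸ hr)
  rw [h0, dist_eq_zero] at hxp
  exact hxp ▸ hp

theorem mem_hyperplane_iff {d : ℕ} {i : Fin d} (hi : (i : ℕ) = d - 1)
    {y : EuclideanSpace ℝ (Fin d)} : y ∈ hyperplane d ↔ y i = 0 :=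
  ⟨fun h => h i hi, fun h _ hj => Fin.ext (hj.trans hi.symm) ▸ h⟩

/-- A local defining function of `M` at `x`, differentiable and transverse to every normal
vector field, on whose sign domains the intrinsic metric of `Mᶜ` is controlled by the
Euclidean distance. -/
theorem IsCkHypersurface.exists_defining_function {d : ℕ} (hd : 0 < d)
    {M : Set (EuclideanSpace ℝ (Fin d))} (hM : IsCkHypersurface 1 M)
    {x : EuclideanSpace ℝ (Fin d)} (hx : x ∈ M) {v : EuclideanSpace ℝ (Fin d)}
    (hv : ‖v‖ = 1) (hvt : ∀ w, IsTangentVector M x w → ⟪v, w⟫ = 0) :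
    ∃ g : EuclideanSpace ℝ (Fin d) → ℝ, ∃ c : ℝ, ∃ C : ℝ≥0,
      ∃ W : Set (EuclideanSpace ℝ (Fin d)), IsOpen W ∧ x ∈ W ∧ c ≠ 0 ∧
      (∀ y ∈ W, y ∈ M ↔ g y = 0) ∧ HasDerivAt (fun h : ℝ => g (x + h • v)) c 0 ∧
      ∀ y ∈ W, ∀ z ∈ W, 0 < g y * g z → intrinsicDist Mᶜ y z ≤ C * edist y z := by
  obtain ⟨U, V, φ, ψ, hU, hV, hxU, hφ, hψ, hUV, hVU, hψφ, hφψ, hMU⟩ := hM x hx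
  have hmem : ∀ y ∈ U, y ∈ M ↔ φ y ∈ hyperplane d := by
    intro y hy
    constructor
    · intro h
      exact (hMU.subset ⟨y, ⟨h, hy⟩, rfl⟩).1
    · intro h
      obtain ⟨z, ⟨hzM, hzU⟩, hz⟩ := hMU.superset ⟨h, hUV hy⟩
      rwa [← hψφ y hy, ← hz, hψφ z hzU]
  let i : Fin d := ⟨d - 1, by omega⟩
  have hi : (i : ℕ) = d - 1 := rfl
  have hmemi : ∀ y ∈ U, y ∈ M ↔ φ y i = 0 := fun y hy =>
    (hmem y hy).trans (mem_hyperplane_iff hi)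
  have hφx : ContDiffAt ℝ 1 φ x := hφ.contDiffAt (hU.mem_nhds hxU)
  have hψx : ContDiffAt ℝ 1 ψ (φ x) := hψ.contDiffAt (hV.mem_nhds (hUV hxU))
  have hφ' : HasFDerivAt φ (fderiv ℝ φ x) x :=
    (hφx.differentiableAt one_ne_zero).hasFDerivAt
  have hψ' : HasFDerivAt ψ (fderiv ℝ ψ (φ x)) (φ x) :=
    (hψx.differentiableAt one_ne_zero).hasFDerivAt
  have hinv : fderiv ℝ ψ (φ x) (fderiv ℝ φ x v) = v := by
    have h1 : HasFDerivAt (ψ ∘ φ) ((fderiv ℝ ψ (φ x)).comp (fderiv ℝ φ x)) x := hψ'.comp x hφ'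
    have h2 : HasFDerivAt (ψ ∘ φ) (ContinuousLinearMap.id ℝ _) x :=
      (hasFDerivAt_id x).congr_of_eventuallyEq
        (Filter.eventually_of_mem (hU.mem_nhds hxU) hψφ)
    exact DFunLike.congr_fun (h1.unique h2) v
  have hc : fderiv ℝ φ x v i ≠ 0 := by
    intro h0
    set w := fderiv ℝ φ x v with hw
    have hline : HasDerivAt (fun t : ℝ => φ x + t • w) w 0 := by
      simpa using ((hasDerivAt_id (0 : ℝ)).smul_const w).const_add (φ x)
    have hcont : Continuous fun t : ℝ => φ x + t • w := by fun_prop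
    obtain ⟨ε, hε, hball⟩ := Metric.mem_nhds_iff.1
      (hcont.continuousAt.preimage_mem_nhds (x := (0 : ℝ)) (by
        simpa using hV.mem_nhds (hUV hxU)))
    have hIoo : ∀ t ∈ Ioo (-ε) ε, φ x + t • w ∈ V := fun t ht =>
      hball (by simpa [abs_lt] using ht)
    have htan : IsTangentVector M x v := by
      refine ⟨ε, hε, fun t => ψ (φ x + t • w), ?_, ?_, ?_, ?_⟩
      · intro t ht
        rw [hmemi _ (hVU (hIoo t ht)), hφψ _ (hIoo t ht)]
        have := (hmemi x hxU).1 hx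
        simp [this, h0]
      · exact hψ.comp (by fun_prop) hIoo
      · simpa using hψφ x hxU
      · have h1 : HasFDerivAt ψ (fderiv ℝ ψ (φ x)) (φ x + (0 : ℝ) • w) := by simpa using hψ'
        have := h1.comp_hasDerivAt (0 : ℝ) hline
        rwa [hinv] at this
    have := hvt v htan
    rw [real_inner_self_eq_norm_sq, hv] at this
    norm_num at this
  obtain ⟨K₁, t₁, ht₁, hK₁⟩ := hφx.exists_lipschitzOnWith
  obtain ⟨K₂, t₂, ht₂, hK₂⟩ := hψx.exists_lipschitzOnWith
  obtain ⟨r, hr, hball⟩ := Metric.mem_nhds_iff.1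
    (Filter.inter_mem ht₂ (hV.mem_nhds (hUV hxU)))
  have hWn : t₁ ∩ U ∩ φ ⁻¹' ball (φ x) r ∈ nhds x :=
    Filter.inter_mem (Filter.inter_mem ht₁ (hU.mem_nhds hxU))
      (hφx.continuousAt.preimage_mem_nhds (ball_mem_nhds _ hr))
  obtain ⟨W, hWsub, hWo, hxW⟩ := _root_.mem_nhds_iff.1 hWn
  refine ⟨fun y => φ y i, _, K₂ * K₁, W, hWo, hxW, hc,
    fun y hy => hmemi y (hWsub hy).1.2, ?_, ?_⟩
  · have hline : HasDerivAt (fun t : ℝ => x + t • v) v 0 := by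
      simpa using ((hasDerivAt_id (0 : ℝ)).smul_const v).const_add x
    have h1 : HasFDerivAt φ (fderiv ℝ φ x) (x + (0 : ℝ) • v) := by simpa using hφ'
    exact ((EuclideanSpace.proj (𝕜 := ℝ) i).hasFDerivAt).comp_hasDerivAt (0 : ℝ)
      (h1.comp_hasDerivAt (0 : ℝ) hline)
  · intro y hy z hz hyz
    obtain ⟨⟨hy₁, hyU⟩, hyb⟩ := hWsub hy
    obtain ⟨⟨hz₁, hzU⟩, hzb⟩ := hWsub hz
    have hseg : ∀ t ∈ Icc (0 : ℝ) 1, AffineMap.lineMap (φ y) (φ z) t ∈ ball (φ x) r :=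
      fun t ht => (convex_ball (φ x) r).lineMap_mem hyb hzb ht
    have hle := intrinsicDist_le_of_lipschitzOn_segment (A := Mᶜ) (a := φ y) (b := φ z) hK₂
      (fun t ht => (hball (hseg t ht)).1) (by
        intro t ht hmemM
        have hVt := (hball (hseg t ht)).2
        rw [hmemi _ (hVU hVt), hφψ _ hVt] at hmemM
        simp only [AffineMap.lineMap_apply_module, PiLp.add_apply, PiLp.smul_apply,
          smul_eq_mul] at hmemM
        obtain ⟨ht0, ht1⟩ := ht
        rcases mul_pos_iff.1 hyz with ⟨ha, hb⟩ | ⟨ha, hb⟩ <;>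
          rcases ht0.eq_or_lt with rfl | ht0 <;> nlinarith)
    rw [hψφ y hyU, hψφ z hzU] at hle
    calc _ ≤ _ := hle
      _ ≤ K₂ * (K₁ * edist y z) := by gcongr; exact hK₁ hy₁ hz₁
      _ = _ := by rw [ENNReal.coe_mul, mul_assoc]

theorem eventually_mul_pos_of_hasDerivAt {g : ℝ → ℝ} {c : ℝ} (hg : HasDerivAt g c 0)
    (hg0 : g 0 = 0) (hc : c ≠ 0) :
    ∀ᶠ h in nhdsWithin (0 : ℝ) {0}ᶜ, 0 < g h * (h * c) := by
  have h1 := (hasDerivAt_iff_tendsto_slope.1 hg).mul_const c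
  filter_upwards [h1.eventually_const_lt (mul_self_pos.2 hc), self_mem_nhdsWithin] with h hh hne
  have hne : h ≠ 0 := hne
  rw [slope_def_field, hg0, sub_zero, sub_zero] at hh
  have : g h * (h * c) = (g h / h * c) * (h * h) := by field_simp
  rw [this]
  exact mul_pos hh (mul_self_pos.2 hne)

/-- continuity from intrinsic Lipschitz continuity off the
hypersurface and normal limits. Let `M ⊆ ℝ^d` be a nonempty `C^1`-hypersurface of
positive reach with normal vector `n` along `M`, and let `f : ℝ^d → ℝ^d` be intrinsic
Lipschitz continuous on `ℝ^d \ M`. Assume that for every `x ∈ M` the limit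
`lim_{h → 0} f(x + h n(x))` exists and equals `f(x)`. Then `f` is continuous. -/
theorem continuous_of_normal_limits
    (d : ℕ) (hd : 0 < d)
    (M : Set (EuclideanSpace ℝ (Fin d))) (hMne : M.Nonempty)
    (hM : IsCkHypersurface 1 M) (hMreach : 0 < reach M)
    (n : EuclideanSpace ℝ (Fin d) → EuclideanSpace ℝ (Fin d))
    (hn : IsNormalVector M n)
    (f : EuclideanSpace ℝ (Fin d) → EuclideanSpace ℝ (Fin d))
    (hf : ∃ L : ℝ≥0, IntrinsicLipschitzWith L Mᶜ f)
    (hlim : ∀ x ∈ M, Filter.Tendsto (fun h : ℝ => f (x + h • n x))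
      (nhdsWithin 0 {(0 : ℝ)}ᶜ) (nhds (f x))) :
    Continuous f := by
  obtain ⟨L, hL⟩ := hf
  have hMc : IsClosed M := isClosed_of_reach_pos hMne hMreach
  have hray : ∀ x, Tendsto (fun h : ℝ => x + h • n x) (nhdsWithin 0 {(0 : ℝ)}ᶜ) (nhds x) := by
    intro x
    have : Continuous fun h : ℝ => x + h • n x := by fun_prop
    simpa using (this.tendsto 0).mono_left nhdsWithin_le_nhds
  have hoff : ∀ y ∈ M, ∀ᶠ h in nhdsWithin (0 : ℝ) {0}ᶜ, y + h • n y ∉ M := by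
    intro y hy
    obtain ⟨g, c, C, W, hWo, hyW, hc, hgM, hg, -⟩ :=
      hM.exists_defining_function hd hy (hn.2.1 y hy) (hn.2.2 y hy)
    filter_upwards [eventually_mul_pos_of_hasDerivAt hg (by simpa using (hgM y hyW).1 hy) hc,
      (hray y).eventually (hWo.mem_nhds hyW)] with h hh hW hmem
    rw [(hgM _ hW).1 hmem, zero_mul] at hh
    exact hh.false
  rw [continuous_iff_continuousAt]
  intro x
  suffices h : ∃ C : ℝ≥0, ∀ᶠ y in nhds x, edist (f y) (f x) ≤ C * edist y x by
    obtain ⟨C, hC⟩ := h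
    have hlim0 : Tendsto (fun y => (C : ℝ≥0∞) * edist y x) (nhds x) (nhds 0) := by
      have : Tendsto (fun y => edist y x) (nhds x) (nhds 0) :=
        tendsto_iff_edist_tendsto_0.1 tendsto_id
      simpa using ENNReal.Tendsto.const_mul this (Or.inr ENNReal.coe_ne_top)
    exact tendsto_iff_edist_tendsto_0.2
      (tendsto_of_tendsto_of_tendsto_of_le_of_le' tendsto_const_nhds hlim0
        (Eventually.of_forall fun _ => zero_le) hC)
  by_cases hx : x ∈ M
  · obtain ⟨g, c, C, W, hWo, hxW, hc, hgM, hg, hWC⟩ :=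
      hM.exists_defining_function hd hx (hn.2.1 x hx) (hn.2.2 x hx)
    have hside : ∀ y ∈ W, y ∉ M → edist (f y) (f x) ≤ (L * C : ℝ≥0) * edist y x := by
      intro y hy hyM
      have hgy : g y ≠ 0 := fun h => hyM ((hgM y hy).2 h)
      have hfreq : ∃ᶠ h in nhdsWithin (0 : ℝ) {0}ᶜ, 0 < h * (c * g y) := by
        rcases (mul_ne_zero hc hgy).lt_or_gt with h | h
        · have : ∃ᶠ h in nhdsWithin (0 : ℝ) (Iio 0), 0 < h * (c * g y) :=
            Eventually.frequently <| by
              filter_upwards [self_mem_nhdsWithin] with t ht using mul_pos_of_neg_of_neg ht h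
          exact this.filter_mono (nhdsWithin_mono _ fun t ht => ne_of_lt ht)
        · have : ∃ᶠ h in nhdsWithin (0 : ℝ) (Ioi 0), 0 < h * (c * g y) :=
            Eventually.frequently <| by
              filter_upwards [self_mem_nhdsWithin] with t ht using mul_pos ht h
          exact this.filter_mono (nhdsWithin_mono _ fun t ht => ne_of_gt ht)
      have hle : ∃ᶠ h in nhdsWithin (0 : ℝ) {0}ᶜ,
          edist (f y) (f (x + h • n x)) ≤ (L * C : ℝ≥0) * edist y (x + h • n x) := by
        refine (hfreq.and_eventually
          ((eventually_mul_pos_of_hasDerivAt hg (by simpa using (hgM x hxW).1 hx) hc).and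
            (((hray x).eventually (hWo.mem_nhds hxW)).and (hoff x hx)))).mono ?_
        rintro h ⟨h1, h2, h3, h4⟩
        have hpos : 0 < g y * g (x + h • n x) := by
          have h5 : 0 < (g y * g (x + h • n x)) * (h * c) ^ 2 := by
            calc 0 < _ := mul_pos h1 h2
              _ = _ := by ring
          exact pos_of_mul_pos_left h5 (sq_nonneg _)
        calc _ ≤ _ := hL y hyM _ h4
          _ ≤ L * (C * edist y (x + h • n x)) := by gcongr; exact hWC y hy _ h3 hpos
          _ = _ := by rw [ENNReal.coe_mul, mul_assoc]
      exact le_of_tendsto_of_tendsto_of_frequently (tendsto_const_nhds.edist (hlim x hx))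
        (ENNReal.Tendsto.const_mul (tendsto_const_nhds.edist (hray x))
          (Or.inr ENNReal.coe_ne_top)) hle
    refine ⟨L * C, Filter.eventually_of_mem (hWo.mem_nhds hxW) fun y hy => ?_⟩
    by_cases hyM : y ∈ M
    · refine le_of_tendsto_of_tendsto ((hlim y hyM).edist tendsto_const_nhds)
        (ENNReal.Tendsto.const_mul ((hray y).edist tendsto_const_nhds)
          (Or.inr ENNReal.coe_ne_top)) ?_
      filter_upwards [hoff y hyM, (hray y).eventually (hWo.mem_nhds hy)] with h h1 h2
      exact hside _ h2 h1
    · exact hside y hy hyM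
  · obtain ⟨r, hr, hball⟩ := Metric.isOpen_iff.1 hMc.isOpen_compl x hx
    refine ⟨L, Filter.eventually_of_mem (ball_mem_nhds x hr) fun y hy => ?_⟩
    have hseg : ∀ t ∈ Icc (0 : ℝ) 1, AffineMap.lineMap y x t ∈ ball x r :=
      fun t ht => (convex_ball x r).lineMap_mem hy (mem_ball_self hr) ht
    calc _ ≤ _ := hL y (hball hy) x hx
      _ ≤ L * edist y x := by
        gcongr
        simpa using intrinsicDist_le_of_lipschitzOn_segment (A := Mᶜ)
          (LipschitzWith.id.lipschitzOnWith (s := univ)) (fun _ _ => mem_univ _)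
          (fun t ht => hball (hseg t ht))
end
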